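/- Let d ≥ 3, u > 0, ε ∈ (0,1/2), and let s be a positive integer. There exist constants c = c(d,u,s,ε) > 0 and C = C(d,u,s,ε) < ∞ such that for every x ∈ Z^d and every positive integer T, the recursively defined random sets U^{(1)}, ..., U^{(s)} satisfy P[ ∩_{i=1}^s { cap(U^{(i)}) ≥ c · min( T^{i(1−ε)/2}, T^{(d−2)(1−ε)/2} ) } ] ≥ 1 − C exp(−c T^{ε/2}). -/

import Mathlib

open MeasureTheory ProbabilityTheory
open scoped ENNReal NNReal

/-- Points of the lattice `ℤ^d`. -/
abbrev Zd (d : ℕ) := Fin d → ℤ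

/-- The `ℓ^∞` norm of a lattice point. -/
def norminf {d : ℕ} (x : Zd d) : ℕ := Finset.univ.sup fun j => (x j).natAbs

/-- `x` and `y` are nearest neighbours in `ℤ^d` (their `ℓ^1` distance is `1`). -/
def IsStep {d : ℕ} (x y : Zd d) : Prop := (∑ j, (y j - x j).natAbs) = 1

/-- Discrete ball (in `ℤ^d`, `ℓ^∞` distance) with real center and radius. -/
def ballZR (d : ℕ) (c : Fin d → ℝ) (r : ℝ) : Set (Zd d) :=
  {y | ∀ j, |(y j : ℝ) - c j| ≤ r}

/-- `t`-step transition probability of simple random walk on `ℤ^d`. -/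
noncomputable def stepP (d : ℕ) : ℕ → Zd d → Zd d → ℝ
  | 0, x, y => if x = y then 1 else 0
  | n+1, x, y => (∑ j : Fin d,
      (stepP d n (Function.update x j (x j + 1)) y +
       stepP d n (Function.update x j (x j - 1)) y)) / (2 * d)

/-- The Green function of simple random walk on `ℤ^d`. -/
noncomputable def green (d : ℕ) (x y : Zd d) : ℝ := ∑' n : ℕ, stepP d n x y

/-- The energy of a (finitely supported) measure `ν`, carried by the finite set `s`. -/
noncomputable def energy (d : ℕ) (s : Finset (Zd d)) (ν : Zd d → ℝ) : ℝ :=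
  ∑ z ∈ s, ∑ w ∈ s, green d z w * ν z * ν w

/-- The capacity of `K ⊆ ℤ^d`: the inverse of the infimum of the energies of probability
measures carried by `K` (with the conventions `sInf ∅ = 0`, `0⁻¹ = 0`, this gives
`capacity d ∅ = 0`). -/
noncomputable def capacity (d : ℕ) (K : Set (Zd d)) : ℝ :=
  (sInf {E : ℝ | ∃ (s : Finset (Zd d)) (ν : Zd d → ℝ), ↑s ⊆ K ∧
    (∀ z, 0 ≤ ν z) ∧ (∀ z ∉ s, ν z = 0) ∧ (∑ z ∈ s, ν z) = 1 ∧ E = energy d s ν})⁻¹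

open Classical in
/-- `X` is a simple random walk on `ℤ^d` started at `x0`, under the probability measure `P`:
a walk follows nearest-neighbour paths, each of the `(2d)^n` admissible length-`n` paths from
`x0` having probability `(2d)⁻ⁿ`. -/
def IsSRW (d : ℕ) {Ω : Type} [MeasurableSpace Ω] (P : Measure Ω)
    (X : ℕ → Ω → Zd d) (x0 : Zd d) : Prop :=
  (∀ t, Measurable (X t)) ∧
  ∀ (n : ℕ) (w : ℕ → Zd d),
    P {ω | ∀ k ≤ n, X k ω = w k} =
      if w 0 = x0 ∧ ∀ k < n, IsStep (w k) (w (k+1))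
      then ((2 * d : ℝ≥0∞))⁻¹ ^ n else 0

/-- The set `Φ(X̄_N, T)`: all points visited by the walks `X 0, …, X (N-1)` during times
`1, …, T`. -/
def Phi (d : ℕ) {Ω : Type} (X : ℕ → ℕ → Ω → Zd d) (N T : ℕ) (ω : Ω) : Set (Zd d) :=
  {z | ∃ i < N, ∃ t, 1 ≤ t ∧ t ≤ T ∧ X i t ω = z}

/-- The function `F(n,d)` : `√n` for `d = 3`, `log n` for `d = 4`, and `1` for `d ≥ 5`. -/
noncomputable def Ffn (d n : ℕ) : ℝ :=
  if d = 3 then Real.sqrt n else if d = 4 then Real.log n else 1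
open Classical in
/-- `escProb d A n z` is the probability that a simple random walk started at `z` stays
outside `A` at all times `1, …, n`. -/
noncomputable def escProb (d : ℕ) (A : Set (Zd d)) : ℕ → Zd d → ℝ
  | 0, _ => 1
  | n+1, z => (∑ j : Fin d,
      ((if Function.update z j (z j + 1) ∈ A then 0
        else escProb d A n (Function.update z j (z j + 1))) +
       (if Function.update z j (z j - 1) ∈ A then 0
        else escProb d A n (Function.update z j (z j - 1))))) / (2 * d)

open Classical in
/-- The equilibrium measure of `A`: `e_A(z) = P_z[X(t) ∉ A for all t ≥ 1]` for `z ∈ A`,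
and `0` otherwise. -/
noncomputable def eqMeasure (d : ℕ) (A : Set (Zd d)) (z : Zd d) : ℝ :=
  if z ∈ A then ⨅ n : ℕ, escProb d A n z else 0

/-- The normalized equilibrium measure `ẽ_A = e_A / cap(A)`. -/
noncomputable def neqMeasure (d : ℕ) (A : Set (Zd d)) (z : Zd d) : ℝ :=
  eqMeasure d A z / capacity d A

/-- The Poisson(`lam`) probability of the value `n`. -/
noncomputable def poissonProb (lam : ℝ) (n : ℕ) : ℝ :=
  Real.exp (-lam) * lam ^ n / n.factorial

open Classical in
/-- The probability that a simple random walk whose starting point has (sub-)probability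
density `ν` follows the path `w 0, w 1, …, w m` during its first `m` steps. -/
noncomputable def pathProb (d : ℕ) (ν : Zd d → ℝ) (m : ℕ) (w : ℕ → Zd d) : ℝ :=
  if ∀ k < m, IsStep (w k) (w (k+1)) then ν (w 0) * ((2 * (d : ℝ)))⁻¹ ^ m else 0

/-- Under `P`, `N` is Poisson with parameter `u ⬝ cap K` and, given `N`, the walks
`Y 0, …, Y (N-1)` are independent simple random walks whose starting points are i.i.d.
with distribution the normalized equilibrium measure of `K`. -/
def HasLevelLaw (d : ℕ) (u : ℝ) {Ω : Type} [MeasurableSpace Ω] (P : Measure Ω)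
    (K : Set (Zd d)) (N : Ω → ℕ) (Y : ℕ → ℕ → Ω → Zd d) : Prop :=
  (∀ i t, Measurable (Y i t)) ∧ Measurable N ∧
  ∀ (n m : ℕ) (w : ℕ → ℕ → Zd d),
    P {ω | N ω = n ∧ ∀ k < n, ∀ t ≤ m, Y k t ω = w k t} =
      ENNReal.ofReal (poissonProb (u * capacity d K) n *
        ∏ k ∈ Finset.range n, pathProb d (neqMeasure d K) m (w k))

/-- The recursively defined random sets `U⁽ⁱ⁾ = U⁽ⁱ⁾(x,T)`: `U⁽¹⁾` is the range of the walk
`X` during times `1, …, T`, and for `i ≥ 2`, `U⁽ⁱ⁾` is the set of points visited, during times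
`1, …, T`, by the `N i` walks `Y i 0, …, Y i (N i - 1)`. -/
def Uset (d T : ℕ) {Ω : Type} (X : ℕ → Ω → Zd d) (N : ℕ → Ω → ℕ)
    (Y : ℕ → ℕ → ℕ → Ω → Zd d) (i : ℕ) (ω : Ω) : Set (Zd d) :=
  if i ≤ 1 then {z | ∃ t, 1 ≤ t ∧ t ≤ T ∧ X t ω = z}
  else {z | ∃ k < N i ω, ∃ t, 1 ≤ t ∧ t ≤ T ∧ Y i k t ω = z}


/-! ### Basic walk facts -/

lemma upd_add {d : ℕ} (x : Zd d) (j : Fin d) (a : ℤ) :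
    Function.update x j (x j + a) = x + Pi.single j a := by
  ext i
  by_cases h : i = j
  · subst h; simp
  · simp [h]

lemma upd_sub {d : ℕ} (x : Zd d) (j : Fin d) (a : ℤ) :
    Function.update x j (x j - a) = x - Pi.single j a := by
  ext i
  by_cases h : i = j
  · subst h; simp
  · simp [h]

noncomputable def boxMeas (d : ℕ) : Measure (Fin d → ℝ) :=
  Measure.pi (fun _ => (volume : Measure ℝ).restrict (Set.Ioc (-Real.pi) Real.pi))

instance (d : ℕ) : IsFiniteMeasure (boxMeas d) := by
  unfold boxMeas; infer_instance

noncomputable def phiC (d : ℕ) (θ : Fin d → ℝ) : ℝ := (∑ j, Real.cos (θ j)) / d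

lemma continuous_phiC (d : ℕ) : Continuous (phiC d) := by
  unfold phiC; fun_prop

lemma abs_phiC_le (d : ℕ) (θ : Fin d → ℝ) : |phiC d θ| ≤ 1 := by
  unfold phiC
  rw [abs_div, Nat.abs_cast]
  apply div_le_one_of_le₀ _ (by positivity)
  calc |∑ j, Real.cos (θ j)| ≤ ∑ j, |Real.cos (θ j)| := Finset.abs_sum_le_sum_abs _ _
    _ ≤ ∑ j : Fin d, 1 := Finset.sum_le_sum fun j _ => Real.abs_cos_le_one _
    _ = d := by simp

noncomputable def dotp {d : ℕ} (θ : Fin d → ℝ) (z : Zd d) : ℝ := ∑ j, θ j * z j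

lemma dotp_add {d : ℕ} (θ : Fin d → ℝ) (z w : Zd d) : dotp θ (z + w) = dotp θ z + dotp θ w := by
  simp [dotp, mul_add, Finset.sum_add_distrib]
lemma dotp_sub {d : ℕ} (θ : Fin d → ℝ) (z w : Zd d) : dotp θ (z - w) = dotp θ z - dotp θ w := by
  simp [dotp, mul_sub, Finset.sum_sub_distrib]
lemma dotp_single {d : ℕ} (θ : Fin d → ℝ) (j : Fin d) : dotp θ (Pi.single j 1) = θ j := by
  unfold dotp
  rw [Finset.sum_eq_single j]
  · simp
  · intro b _ hb; simp [hb]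
  · simp
lemma continuous_dotp {d : ℕ} (z : Zd d) : Continuous (fun θ => dotp θ z) := by
  unfold dotp; fun_prop

noncomputable def FI (d n : ℕ) (z : Zd d) : ℝ :=
  ∫ θ, phiC d θ ^ n * Real.cos (dotp θ z) ∂(boxMeas d)

lemma FI_integrable (d n : ℕ) (z : Zd d) :
    Integrable (fun θ => phiC d θ ^ n * Real.cos (dotp θ z)) (boxMeas d) := by
  apply Integrable.of_bound (C := 1)
  · exact (((continuous_phiC d).pow n).mul
      (Real.continuous_cos.comp (continuous_dotp z))).aestronglyMeasurable
  · refine Filter.Eventually.of_forall fun θ => ?_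
    rw [Real.norm_eq_abs, abs_mul, abs_pow]
    exact mul_le_one₀ (pow_le_one₀ (abs_nonneg _) (abs_phiC_le d θ)) (abs_nonneg _)
      (Real.abs_cos_le_one _)

lemma FI_rec (d n : ℕ) (hd : 0 < d) (z : Zd d) :
    FI d (n+1) z = (∑ j : Fin d, (FI d n (z - Pi.single j 1) + FI d n (z + Pi.single j 1))) / (2*d) := by
  have hd' : (d : ℝ) ≠ 0 := by positivity
  unfold FI
  have : ∀ j : Fin d, (∫ θ, phiC d θ ^ n * Real.cos (dotp θ (z - Pi.single j 1)) ∂(boxMeas d)) +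
      (∫ θ, phiC d θ ^ n * Real.cos (dotp θ (z + Pi.single j 1)) ∂(boxMeas d)) =
      ∫ θ, (phiC d θ ^ n * Real.cos (dotp θ (z - Pi.single j 1)) +
        phiC d θ ^ n * Real.cos (dotp θ (z + Pi.single j 1))) ∂(boxMeas d) := fun j =>
    (integral_add (FI_integrable d n _) (FI_integrable d n _)).symm
  simp_rw [this]
  have hi : ∀ j ∈ (Finset.univ : Finset (Fin d)), Integrable (fun θ => phiC d θ ^ n * Real.cos (dotp θ (z - Pi.single j 1)) +
        phiC d θ ^ n * Real.cos (dotp θ (z + Pi.single j 1))) (boxMeas d) := fun j _ =>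
    (FI_integrable d n _).add (FI_integrable d n _)
  rw [← integral_finsetSum _ hi, ← integral_div]
  congr 1
  ext θ
  simp_rw [dotp_add, dotp_sub, dotp_single, Real.cos_add, Real.cos_sub]
  have : ∀ j : Fin d, phiC d θ ^ n * (Real.cos (dotp θ z) * Real.cos (θ j) + Real.sin (dotp θ z) * Real.sin (θ j)) + phiC d θ ^ n * (Real.cos (dotp θ z) * Real.cos (θ j) - Real.sin (dotp θ z) * Real.sin (θ j)) = 2 * phiC d θ ^ n * Real.cos (dotp θ z) * Real.cos (θ j) := fun j => by ring
  simp_rw [this]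
  rw [← Finset.mul_sum, pow_succ]
  conv_lhs => rw [phiC]
  field_simp
  simp only [phiC, div_pow]
  ring

lemma exp_int (k : ℤ) : ∫ t in Set.Ioc (-Real.pi) Real.pi, Complex.exp (((t * k : ℝ) : ℂ) * Complex.I)
    = if k = 0 then ((2 * Real.pi : ℝ) : ℂ) else 0 := by
  rw [← intervalIntegral.integral_of_le (by linarith [Real.pi_pos])]
  split_ifs with h
  · subst h
    simp
    ring
  · have hc : ((k : ℂ) * Complex.I) ≠ 0 := by simp [h]
    have := integral_exp_mul_complex (a := -Real.pi) (b := Real.pi) hc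
    have e : ∀ t : ℝ, ((t * k : ℝ) : ℂ) * Complex.I = (k * Complex.I) * t := fun t => by
      push_cast; ring
    simp_rw [e]
    rw [this]
    have h2 : Complex.exp (k * Complex.I * (Real.pi : ℝ)) = Complex.exp (k * Complex.I * ((-Real.pi : ℝ))) := by
      rw [Complex.exp_eq_exp_iff_exists_int]
      refine ⟨k, ?_⟩
      push_cast; ring
    rw [h2]; simp

lemma FI_zero (d : ℕ) (z : Zd d) : FI d 0 z = if z = 0 then (2 * Real.pi) ^ d else 0 := by
  unfold FI
  have h1 : ∫ θ, ∏ j, Complex.exp (((θ j * z j : ℝ) : ℂ) * Complex.I) ∂(boxMeas d) =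
      ∏ j : Fin d, if z j = 0 then ((2 * Real.pi : ℝ) : ℂ) else 0 := by
    unfold boxMeas
    rw [integral_fintype_prod_eq_prod (𝕜 := ℂ) (fun j (t : ℝ) => Complex.exp (((t * z j : ℝ) : ℂ) * Complex.I))]
    exact Finset.prod_congr rfl fun j _ => exp_int (z j)
  have h2 : ∀ θ : Fin d → ℝ, ∏ j, Complex.exp (((θ j * z j : ℝ) : ℂ) * Complex.I) =
      Complex.exp ((dotp θ z : ℝ) * Complex.I) := fun θ => by
    rw [← Complex.exp_sum, ← Finset.sum_mul, dotp, Complex.ofReal_sum]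
  simp_rw [h2] at h1
  have hintg : Integrable (fun θ : Fin d → ℝ => Complex.exp ((dotp θ z : ℝ) * Complex.I)) (boxMeas d) := by
    apply Integrable.of_bound (C := 1)
    · have := continuous_dotp z
      exact (by fun_prop : Continuous (fun θ : Fin d → ℝ => Complex.exp ((dotp θ z : ℝ) * Complex.I))).aestronglyMeasurable
    · refine Filter.Eventually.of_forall fun θ => ?_
      rw [Complex.norm_exp_ofReal_mul_I]
  have h3 := integral_re hintg
  rw [h1] at h3
  have h4 : ∀ θ : Fin d → ℝ, phiC d θ ^ 0 * Real.cos (dotp θ z) = RCLike.re (Complex.exp ((dotp θ z : ℝ) * Complex.I)) := fun θ => by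
    rw [pow_zero, one_mul]
    exact (Complex.exp_ofReal_mul_I_re _).symm
  simp_rw [h4]
  rw [h3]
  split_ifs with h
  · subst h
    have := Complex.ofReal_re ((2 * Real.pi) ^ d)
    push_cast at this
    simpa using this
  · obtain ⟨j, hj⟩ : ∃ j, z j ≠ 0 := by
      by_contra hh; push Not at hh; exact h (funext hh)
    rw [Finset.prod_eq_zero (Finset.mem_univ j) (by simp [hj])]
    simp

lemma stepP_eq_FI (d : ℕ) (hd : 0 < d) (n : ℕ) : ∀ x y : Zd d,
    stepP d n x y = FI d n (y - x) / (2 * Real.pi) ^ d := by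
  have : (2 * Real.pi) ^ d ≠ 0 := by positivity
  induction n with
  | zero =>
    intro x y
    rw [FI_zero, stepP]
    by_cases h : x = y
    · subst h; simp [this]
    · have : y - x ≠ 0 := fun hh => h (sub_eq_zero.mp hh).symm
      simp [h, this]
  | succ n ih =>
    intro x y
    rw [stepP, FI_rec d n hd]
    simp_rw [ih, upd_add, upd_sub, ← add_div]
    rw [← Finset.sum_div, div_right_comm]
    have : ∀ j : Fin d, FI d n (y - (x + Pi.single j 1)) + FI d n (y - (x - Pi.single j 1)) =
        FI d n (y - x - Pi.single j 1) + FI d n (y - x + Pi.single j 1) := fun j => by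
      congr 2 <;> abel
    simp_rw [this]

lemma stepP_nonneg (d : ℕ) (n : ℕ) : ∀ x y : Zd d, 0 ≤ stepP d n x y := by
  induction n with
  | zero => intro x y; rw [stepP]; split_ifs <;> norm_num
  | succ n ih =>
    intro x y; rw [stepP]
    exact div_nonneg (Finset.sum_nonneg fun j _ => add_nonneg (ih _ _) (ih _ _)) (by positivity)

/-! ### Heat kernel bound -/

lemma abs_cos_le_sin (t : ℝ) : |Real.cos t| ≤ 1 - Real.sin t ^ 2 / 2 := by
  have h := Real.sin_sq_add_cos_sq t
  have h1 := Real.abs_cos_le_one t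
  have h2 := sq_abs (Real.cos t)
  nlinarith [abs_nonneg (Real.cos t)]

lemma abs_phiC_pow_le (d n : ℕ) (hd : 0 < d) (θ : Fin d → ℝ) :
    |phiC d θ| ^ n ≤ ∏ j, Real.exp (-(n / (2 * d)) * Real.sin (θ j) ^ 2) := by
  have hd' : (0 : ℝ) < d := by positivity
  have h1 : |phiC d θ| ≤ Real.exp (-(1 / (2 * d)) * ∑ j, Real.sin (θ j) ^ 2) := by
    have : |phiC d θ| ≤ 1 - (1 / (2 * d)) * ∑ j, Real.sin (θ j) ^ 2 := by
      unfold phiC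
      rw [abs_div, Nat.abs_cast, div_le_iff₀ hd']
      calc |∑ j, Real.cos (θ j)| ≤ ∑ j, |Real.cos (θ j)| := Finset.abs_sum_le_sum_abs _ _
        _ ≤ ∑ j : Fin d, (1 - Real.sin (θ j) ^ 2 / 2) := Finset.sum_le_sum fun j _ => abs_cos_le_sin _
        _ = (1 - (1 / (2 * d)) * ∑ j, Real.sin (θ j) ^ 2) * d := by
          rw [Finset.sum_sub_distrib, ← Finset.sum_div]
          simp; field_simp
    refine this.trans ?_
    have := Real.add_one_le_exp (-(1 / (2 * d)) * ∑ j, Real.sin (θ j) ^ 2)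
    linarith
  calc |phiC d θ| ^ n ≤ Real.exp (-(1 / (2 * d)) * ∑ j, Real.sin (θ j) ^ 2) ^ n :=
        pow_le_pow_left₀ (abs_nonneg _) h1 n
    _ = _ := by
      rw [← Real.exp_nat_mul, ← Real.exp_sum, ← Finset.mul_sum]
      congr 1; ring

lemma sin_sq_lower {x : ℝ} (h : |x| ≤ Real.pi / 2) : (4 / Real.pi ^ 2) * x ^ 2 ≤ Real.sin x ^ 2 := by
  have h1 := Real.mul_le_sin (abs_nonneg x) h
  have h2 : Real.sin |x| ^ 2 = Real.sin x ^ 2 := by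
    rcases abs_choice x with h | h <;> rw [h]
    rw [Real.sin_neg]; ring
  have h3 : 0 ≤ 2 / Real.pi * |x| := by positivity
  have := pow_le_pow_left₀ h3 h1 2
  rw [h2, mul_pow, sq_abs, div_pow] at this
  norm_num at this ⊢
  exact this

lemma gauss_sin (a : ℝ) (ha : 0 < a) :
    ∫ t in Set.Ioc (-Real.pi) Real.pi, Real.exp (-a * Real.sin t ^ 2) ≤
      3 * √(Real.pi / (a * (4 / Real.pi ^ 2))) := by
  set b := a * (4 / Real.pi ^ 2) with hb
  have hb0 : 0 < b := by positivity
  have hpi := Real.pi_pos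
  set G : ℝ → ℝ := fun t => Real.exp (-b * t ^ 2) + Real.exp (-b * (t - Real.pi) ^ 2) + Real.exp (-b * (t + Real.pi) ^ 2) with hG
  have i0 := integrable_exp_neg_mul_sq hb0
  have i1 : Integrable (fun t : ℝ => Real.exp (-b * (t - Real.pi) ^ 2)) := i0.comp_sub_right Real.pi
  have i2 : Integrable (fun t : ℝ => Real.exp (-b * (t + Real.pi) ^ 2)) := i0.comp_add_right Real.pi
  have iG : Integrable G := (i0.add i1).add i2
  have key : ∀ t ∈ Set.Ioc (-Real.pi) Real.pi, Real.exp (-a * Real.sin t ^ 2) ≤ G t := by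
    intro t ht
    have aux : ∀ y : ℝ, |y| ≤ Real.pi / 2 → Real.sin y ^ 2 = Real.sin t ^ 2 →
        Real.exp (-a * Real.sin t ^ 2) ≤ Real.exp (-b * y ^ 2) := by
      intro y hy hs
      apply Real.exp_le_exp.mpr
      have := mul_le_mul_of_nonneg_left (sin_sq_lower hy) ha.le
      rw [hs] at this
      rw [hb]; linarith
    have e1 := Real.exp_pos (-b * t ^ 2)
    have e2 := Real.exp_pos (-b * (t - Real.pi) ^ 2)
    have e3 := Real.exp_pos (-b * (t + Real.pi) ^ 2)
    simp only [hG]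
    by_cases h1 : |t| ≤ Real.pi / 2
    · have := aux t h1 rfl; linarith
    · rw [abs_le, not_and_or] at h1
      rcases h1 with h1 | h1
      · have := aux (t + Real.pi) (by rw [abs_le]; constructor <;> linarith [ht.1, ht.2])
          (by rw [Real.sin_add_pi]; ring)
        linarith
      · have := aux (t - Real.pi) (by rw [abs_le]; constructor <;> linarith [ht.1, ht.2])
          (by rw [Real.sin_sub_pi]; ring)
        linarith
  calc ∫ t in Set.Ioc (-Real.pi) Real.pi, Real.exp (-a * Real.sin t ^ 2)
      ≤ ∫ t in Set.Ioc (-Real.pi) Real.pi, G t := by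
        apply setIntegral_mono_on _ iG.integrableOn measurableSet_Ioc key
        exact ((by fun_prop : Continuous fun t : ℝ => Real.exp (-a * Real.sin t ^ 2)).integrableOn_Icc).mono_set
          Set.Ioc_subset_Icc_self
    _ ≤ ∫ t, G t := setIntegral_le_integral iG (Filter.Eventually.of_forall fun t => by
        simp only [hG, Pi.zero_apply]; positivity)
    _ = 3 * √(Real.pi / b) := by
        simp only [hG]
        have i01 : Integrable (fun t : ℝ => Real.exp (-b * t ^ 2) + Real.exp (-b * (t - Real.pi) ^ 2)) := i0.add i1
        rw [integral_add i01 i2, integral_add i0 i1,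
          integral_sub_right_eq_self (fun t : ℝ => Real.exp (-b * t ^ 2)) Real.pi,
          integral_add_right_eq_self (fun t : ℝ => Real.exp (-b * t ^ 2)) Real.pi,
          integral_gaussian]
        ring

lemma FI_bound (d : ℕ) (hd : 0 < d) : ∃ C : ℝ, 0 < C ∧ ∀ (n : ℕ), 0 < n → ∀ z : Zd d,
    |FI d n z| ≤ C * (n : ℝ) ^ (-(d : ℝ) / 2) := by
  have hd' : (0 : ℝ) < d := by positivity
  set D : ℝ := 3 * √(Real.pi / ((1 / (2 * d)) * (4 / Real.pi ^ 2))) with hD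
  have hpi := Real.pi_pos
  have hD0 : 0 < D := by positivity
  refine ⟨D ^ d, by positivity, fun n hn z => ?_⟩
  have hn' : (0 : ℝ) < n := by positivity
  have h1 : |FI d n z| ≤ ∫ θ, ∏ j, Real.exp (-(n / (2 * d)) * Real.sin (θ j) ^ 2) ∂(boxMeas d) := by
    unfold FI
    rw [← Real.norm_eq_abs]
    refine norm_integral_le_of_norm_le ?_ (Filter.Eventually.of_forall fun θ => ?_)
    · apply Integrable.of_bound (C := 1)
      · exact (by fun_prop : Continuous _).aestronglyMeasurable
      · refine Filter.Eventually.of_forall fun θ => ?_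
        rw [Real.norm_eq_abs, Finset.abs_prod]
        refine Finset.prod_le_one (fun _ _ => abs_nonneg _) fun j _ => ?_
        rw [Real.abs_exp, Real.exp_le_one_iff]
        have : 0 ≤ (n / (2 * d) : ℝ) * Real.sin (θ j) ^ 2 := by positivity
        linarith
    · rw [Real.norm_eq_abs, abs_mul, abs_pow]
      calc _ ≤ |phiC d θ| ^ n * 1 := by gcongr; exact Real.abs_cos_le_one _
        _ ≤ _ := by rw [mul_one]; exact abs_phiC_pow_le d n hd θ
  refine h1.trans ?_
  unfold boxMeas
  rw [integral_fintype_prod_eq_prod (𝕜 := ℝ) (fun (j : Fin d) (t : ℝ) => Real.exp (-(n / (2 * d)) * Real.sin t ^ 2))]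
  rw [Finset.prod_const, Finset.card_univ, Fintype.card_fin]
  have h2 := gauss_sin (n / (2 * d)) (by positivity)
  have h3 : 3 * √(Real.pi / ((n / (2 * d)) * (4 / Real.pi ^ 2))) = D * (n : ℝ) ^ (-(1 : ℝ) / 2) := by
    rw [hD, show Real.pi / (((n : ℝ) / (2 * d)) * (4 / Real.pi ^ 2)) =
      (Real.pi / ((1 / (2 * d)) * (4 / Real.pi ^ 2))) * (n : ℝ)⁻¹ by field_simp,
      Real.sqrt_mul (by positivity), Real.sqrt_eq_rpow ((n : ℝ)⁻¹), Real.inv_rpow hn'.le,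
      neg_div, Real.rpow_neg hn'.le]
    ring
  rw [h3] at h2
  calc _ ≤ (D * (n : ℝ) ^ (-(1 : ℝ) / 2)) ^ d := by
        apply pow_le_pow_left₀ _ h2
        exact integral_nonneg fun t => (Real.exp_pos _).le
    _ = _ := by
      rw [mul_pow, ← Real.rpow_natCast ((n : ℝ) ^ (-(1 : ℝ) / 2)), ← Real.rpow_mul hn'.le]
      congr 2; ring


/-! ### Green function tails -/

/-- The kernel as a function of the displacement. -/
noncomputable def Qk (d n : ℕ) (z : Zd d) : ℝ := stepP d n 0 z

lemma stepP_eq_Qk (d : ℕ) (hd : 0 < d) (n : ℕ) (x y : Zd d) : stepP d n x y = Qk d n (y - x) := by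
  rw [Qk, stepP_eq_FI d hd, stepP_eq_FI d hd, sub_zero]

lemma Qk_nonneg (d n : ℕ) (z : Zd d) : 0 ≤ Qk d n z := stepP_nonneg d n 0 z

lemma dotp_neg {d : ℕ} (θ : Fin d → ℝ) (z : Zd d) : dotp θ (-z) = - dotp θ z := by
  simp [dotp]

lemma Qk_neg (d : ℕ) (hd : 0 < d) (n : ℕ) (z : Zd d) : Qk d n (-z) = Qk d n z := by
  rw [Qk, Qk, stepP_eq_FI d hd, stepP_eq_FI d hd, sub_zero, sub_zero, FI, FI]
  simp_rw [dotp_neg, Real.cos_neg]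

/-- The `2d` possible steps. -/
abbrev St (d : ℕ) := Fin d × Bool

def vec {d : ℕ} (v : St d) : Zd d := if v.2 then Pi.single v.1 1 else - Pi.single v.1 1

lemma Qk_rec (d : ℕ) (hd : 0 < d) (n : ℕ) (z : Zd d) :
    ∑ v : St d, Qk d n (z + vec v) = (2 * d) * Qk d (n+1) z := by
  have hd' : (d : ℝ) ≠ 0 := by positivity
  have h1 : Qk d (n+1) z = (∑ j : Fin d, (Qk d n (z - Pi.single j 1) + Qk d n (z + Pi.single j 1))) / (2*d) := by
    rw [Qk, stepP]
    congr 1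
    refine Finset.sum_congr rfl fun j _ => ?_
    rw [upd_add, upd_sub, stepP_eq_Qk d hd, stepP_eq_Qk d hd]
    congr 2 <;> abel
  rw [h1, Fintype.sum_prod_type]
  simp only [Fintype.sum_bool, vec]
  field_simp
  refine Finset.sum_congr rfl fun j _ => ?_
  simp [sub_eq_add_neg, add_comm]

lemma Qk_bound (d : ℕ) (hd : 0 < d) : ∃ C : ℝ, 0 < C ∧ ∀ (n : ℕ) (z : Zd d),
    Qk d n z ≤ C * ((n : ℝ) + 1) ^ (-(d : ℝ) / 2) := by
  obtain ⟨C, hC, h⟩ := FI_bound d hd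
  have hpi : 0 < (2 * Real.pi) ^ d := by positivity
  refine ⟨C / (2 * Real.pi) ^ d * 2 ^ ((d : ℝ) / 2) + 1, by positivity, fun n z => ?_⟩
  rcases Nat.eq_zero_or_pos n with rfl | hn
  · have : Qk d 0 z ≤ 1 := by rw [Qk, stepP]; split_ifs <;> norm_num
    simp only [Nat.cast_zero, zero_add, Real.one_rpow, mul_one]
    have : 0 < C / (2 * Real.pi) ^ d * 2 ^ ((d : ℝ) / 2) := by positivity
    linarith
  · have hn' : (1 : ℝ) ≤ n := by exact_mod_cast hn
    have h1 := h n hn z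
    rw [Qk, stepP_eq_FI d hd, sub_zero]
    have h2 : FI d n z / (2 * Real.pi) ^ d ≤ C / (2 * Real.pi) ^ d * (n : ℝ) ^ (-(d : ℝ) / 2) := by
      rw [div_mul_eq_mul_div]
      gcongr
      exact (le_abs_self _).trans h1
    have h3 : (n : ℝ) ^ (-(d : ℝ) / 2) ≤ 2 ^ ((d : ℝ) / 2) * ((n : ℝ) + 1) ^ (-(d : ℝ) / 2) := by
      have e : (n : ℝ) ^ (-(d : ℝ) / 2) = 2 ^ ((d : ℝ) / 2) * (2 * (n : ℝ)) ^ (-(d : ℝ) / 2) := by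
        rw [Real.mul_rpow (by norm_num) (by positivity), neg_div, Real.rpow_neg (by norm_num : (0:ℝ) ≤ 2)]
        have : (2 : ℝ) ^ ((d : ℝ) / 2) ≠ 0 := by positivity
        field_simp
      rw [e]
      gcongr 2 ^ ((d : ℝ) / 2) * ?_
      apply Real.rpow_le_rpow_of_nonpos (by positivity) (by linarith)
      rw [neg_div]; simp only [Left.neg_nonpos_iff]; positivity
    have h4 : (0 : ℝ) ≤ ((n : ℝ) + 1) ^ (-(d : ℝ) / 2) := by positivity
    calc _ ≤ _ := h2
      _ ≤ C / (2 * Real.pi) ^ d * (2 ^ ((d : ℝ) / 2) * ((n : ℝ) + 1) ^ (-(d : ℝ) / 2)) := by gcongr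
      _ ≤ _ := by nlinarith

lemma tele_bound (a : ℝ) (ha : 1 ≤ a) : a ^ (-(3:ℝ)/2) ≤ 4 * ((√a)⁻¹ - (√(a+1))⁻¹) := by
  have ha0 : 0 < a := by linarith
  set p := √a with hp
  set q := √(a+1) with hq
  have hp0 : 0 < p := Real.sqrt_pos.mpr ha0
  have hq0 : 0 < q := Real.sqrt_pos.mpr (by linarith)
  have hpp : p ^ 2 = a := Real.sq_sqrt ha0.le
  have hqq : q ^ 2 = a + 1 := Real.sq_sqrt (by linarith)
  have e : a ^ (-(3:ℝ)/2) = (p ^ 3)⁻¹ := by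
    rw [hp, Real.sqrt_eq_rpow, ← Real.rpow_natCast, ← Real.rpow_mul ha0.le, ← Real.rpow_neg ha0.le]
    norm_num
  have hqp : q ≤ 3 / 2 * p := by
    apply le_of_sq_le_sq _ (by positivity)
    rw [mul_pow, hpp, hqq]; linarith
  have hd : (q - p) * (q + p) = 1 := by ring_nf; rw [hpp, hqq]; ring
  rw [e, inv_sub_inv hp0.ne' hq0.ne', ← mul_div_assoc, inv_eq_one_div, div_le_div_iff₀ (by positivity) (by positivity)]
  have hx : q - p = 1 / (q + p) := by field_simp; linarith
  rw [hx, show 4 * (1 / (q + p)) * p ^ 3 = 4 * p ^ 3 / (q + p) by ring, le_div_iff₀ (by positivity)]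
  have : q * (q + p) ≤ 4 * p ^ 2 := by nlinarith
  nlinarith

noncomputable def Gk (d k : ℕ) (z : Zd d) : ℝ := ∑' r, Qk d (r + k) z

lemma Gk_aux (d : ℕ) (hd : 3 ≤ d) : ∃ C : ℝ, 0 < C ∧ ∀ (k : ℕ) (z : Zd d) (n : ℕ),
    ∑ r ∈ Finset.range n, Qk d (r + k) z ≤ C * ((k : ℝ) + 1) ^ (-((d : ℝ) - 2) / 2) := by
  obtain ⟨C, hC, h⟩ := Qk_bound d (by omega)
  have hd3 : (3 : ℝ) ≤ d := by exact_mod_cast hd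
  refine ⟨C * 4, by positivity, fun k z n => ?_⟩
  set f : ℕ → ℝ := fun r => (√((r : ℝ) + k + 1))⁻¹ with hf
  have h1 : ∀ r, Qk d (r + k) z ≤ C * 4 * ((k : ℝ) + 1) ^ (-((d : ℝ) - 3) / 2) * (f r - f (r+1)) := by
    intro r
    have hb := tele_bound ((r : ℝ) + k + 1) (by have : (0:ℝ) ≤ (r:ℝ) + k := by positivity
                                                linarith)
    have h2 := h (r + k) z
    have e : ((r + k : ℕ) + 1 : ℝ) ^ (-(d : ℝ) / 2) = ((r : ℝ) + k + 1) ^ (-((d : ℝ) - 3) / 2) * ((r : ℝ) + k + 1) ^ (-(3:ℝ)/2) := by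
      rw [← Real.rpow_add (by positivity)]
      push_cast; congr 1; ring
    have h3 : ((r : ℝ) + k + 1) ^ (-((d : ℝ) - 3) / 2) ≤ ((k : ℝ) + 1) ^ (-((d : ℝ) - 3) / 2) := by
      apply Real.rpow_le_rpow_of_nonpos (by positivity)
      · have : (0:ℝ) ≤ r := by positivity
        linarith
      · linarith
    rw [e] at h2
    calc _ ≤ _ := h2
      _ ≤ C * (((k : ℝ) + 1) ^ (-((d : ℝ) - 3) / 2) * (4 * ((√((r : ℝ) + k + 1))⁻¹ - (√((r : ℝ) + k + 1 +1))⁻¹))) := by gcongr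
      _ = _ := by
        simp only [hf]; push_cast
        rw [show (r : ℝ) + 1 + k + 1 = r + k + 1 + 1 by ring]; ring
  calc _ ≤ ∑ r ∈ Finset.range n, C * 4 * ((k : ℝ) + 1) ^ (-((d : ℝ) - 3) / 2) * (f r - f (r+1)) :=
        Finset.sum_le_sum fun r _ => h1 r
    _ = C * 4 * ((k : ℝ) + 1) ^ (-((d : ℝ) - 3) / 2) * (f 0 - f n) := by
      rw [← Finset.mul_sum, Finset.sum_range_sub']
    _ ≤ C * 4 * ((k : ℝ) + 1) ^ (-((d : ℝ) - 3) / 2) * (f 0) := by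
      gcongr
      have : 0 ≤ f n := by simp only [hf]; positivity
      linarith
    _ = _ := by
      simp only [hf, Nat.cast_zero, zero_add]
      rw [Real.sqrt_eq_rpow, ← Real.rpow_neg (by positivity), mul_assoc, ← Real.rpow_add (by positivity)]
      congr 2; ring

lemma Gk_summable (d : ℕ) (hd : 3 ≤ d) (k : ℕ) (z : Zd d) : Summable (fun r => Qk d (r + k) z) := by
  obtain ⟨C, hC, h⟩ := Gk_aux d hd
  exact summable_of_sum_range_le (fun r => Qk_nonneg d _ z) (h k z)

lemma Gk_bound (d : ℕ) (hd : 3 ≤ d) : ∃ C : ℝ, 0 < C ∧ ∀ (k : ℕ) (z : Zd d),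
    Gk d k z ≤ C * ((k : ℝ) + 1) ^ (-((d : ℝ) - 2) / 2) := by
  obtain ⟨C, hC, h⟩ := Gk_aux d hd
  exact ⟨C, hC, fun k z => Real.tsum_le_of_sum_range_le (fun r => Qk_nonneg d _ z) (h k z)⟩

lemma Gk_nonneg (d k : ℕ) (z : Zd d) : 0 ≤ Gk d k z := tsum_nonneg fun r => Qk_nonneg d _ z

lemma Gk_neg (d : ℕ) (hd : 3 ≤ d) (k : ℕ) (z : Zd d) : Gk d k (-z) = Gk d k z := by
  unfold Gk; simp_rw [Qk_neg d (by omega)]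

lemma green_eq (d : ℕ) (hd : 3 ≤ d) (x y : Zd d) : green d x y = Gk d 0 (y - x) := by
  unfold green Gk; simp_rw [stepP_eq_Qk d (by omega : 0 < d), add_zero]

lemma Gk_rec (d : ℕ) (hd : 3 ≤ d) (k : ℕ) (z : Zd d) :
    ∑ v : St d, Gk d k (z + vec v) = (2 * d) * Gk d (k+1) z := by
  unfold Gk
  rw [← Summable.tsum_finsetSum (fun v _ => Gk_summable d hd k _), ← tsum_mul_left]
  simp_rw [Qk_rec d (by omega : 0 < d)]
  rfl

lemma Gk_rec_sub (d : ℕ) (hd : 3 ≤ d) (k : ℕ) (z : Zd d) :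
    ∑ v : St d, Gk d k (z - vec v) = (2 * d) * Gk d (k+1) z := by
  rw [← Gk_neg d hd (k+1), ← Gk_rec d hd]
  refine Finset.sum_congr rfl fun v _ => ?_
  rw [← Gk_neg d hd k]; congr 1; abel

lemma green_nonneg (d : ℕ) (x y : Zd d) : 0 ≤ green d x y := tsum_nonneg fun r => stepP_nonneg d r x y

lemma green_self (d : ℕ) (hd : 3 ≤ d) (x : Zd d) : 1 ≤ green d x x := by
  rw [green_eq d hd, sub_self]
  have := (Gk_summable d hd 0 0).le_tsum 0 (fun j _ => Qk_nonneg d _ _)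
  simpa [Qk, stepP, Gk] using this

/-! ### Capacity lower bound -/

lemma energy_set_bdd (d : ℕ) (hd : 3 ≤ d) (K : Set (Zd d)) (hK : K.Finite) (s : Finset (Zd d)) (ν : Zd d → ℝ)
    (hs : ↑s ⊆ K) (hν : ∀ z, 0 ≤ ν z) (h1 : (∑ z ∈ s, ν z) = 1) :
    1 / ((hK.toFinset.card : ℝ) + 1) ≤ energy d s ν := by
  have hc : (s.card : ℝ) ≤ hK.toFinset.card := by
    exact_mod_cast Finset.card_le_card (fun z hz => hK.mem_toFinset.mpr (hs hz))
  have h2 : ∑ z ∈ s, ν z ^ 2 ≤ energy d s ν := by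
    unfold energy
    refine Finset.sum_le_sum fun z hz => ?_
    calc ν z ^ 2 ≤ green d z z * ν z * ν z := by
          have := green_self d hd z
          nlinarith [mul_self_nonneg (ν z)]
      _ ≤ _ := Finset.single_le_sum (f := fun w => green d z w * ν z * ν w)
          (fun w _ => mul_nonneg (mul_nonneg (green_nonneg d z w) (hν z)) (hν w)) hz
  have h3 : (∑ z ∈ s, ν z) ^ 2 ≤ s.card * ∑ z ∈ s, ν z ^ 2 := sq_sum_le_card_mul_sum_sq
  rw [h1] at h3
  have h4 : 0 ≤ ∑ z ∈ s, ν z ^ 2 := Finset.sum_nonneg fun z _ => sq_nonneg _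
  rw [div_le_iff₀ (by positivity)]
  nlinarith

lemma capacity_ge (d : ℕ) (hd : 3 ≤ d) (K : Set (Zd d)) (hK : K.Finite) {I : Type*} [Fintype I] [Nonempty I]
    (φ : I → Zd d) (hφ : ∀ i, φ i ∈ K) (W : ℝ) (hW : ∑ i, ∑ j, green d (φ i) (φ j) ≤ W) :
    (Fintype.card I : ℝ) ^ 2 / W ≤ capacity d K := by
  classical
  set M : ℝ := (Fintype.card I : ℝ) with hM
  have hM0 : 0 < M := by rw [hM]; exact_mod_cast Fintype.card_pos
  set s := hK.toFinset with hs
  have hmem : ∀ i, φ i ∈ s := fun i => hK.mem_toFinset.mpr (hφ i)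
  set ν : Zd d → ℝ := fun z => (∑ i, if φ i = z then (1:ℝ) else 0) / M with hν
  have hsum : ∀ h : Zd d → ℝ, ∑ z ∈ s, h z * ν z = (∑ i, h (φ i)) / M := by
    intro h
    simp only [hν, ← mul_div_assoc, Finset.mul_sum]
    rw [← Finset.sum_div, Finset.sum_comm]
    congr 1
    refine Finset.sum_congr rfl fun i _ => ?_
    simp [hmem i]
  have hen : energy d s ν = (∑ i, ∑ j, green d (φ i) (φ j)) / M ^ 2 := by
    unfold energy
    have : ∀ z ∈ s, ∑ w ∈ s, green d z w * ν z * ν w = ((∑ j, green d z (φ j)) / M) * ν z := by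
      intro z _
      rw [hsum (fun w => green d z w * ν z), ← Finset.sum_mul]
      ring
    rw [Finset.sum_congr rfl this, hsum (fun z => (∑ j, green d z (φ j)) / M), ← Finset.sum_div]
    field_simp
  set S := {E : ℝ | ∃ (s : Finset (Zd d)) (ν : Zd d → ℝ), ↑s ⊆ K ∧
    (∀ z, 0 ≤ ν z) ∧ (∀ z ∉ s, ν z = 0) ∧ (∑ z ∈ s, ν z) = 1 ∧ E = energy d s ν} with hS
  have hlow : ∀ E ∈ S, 1 / ((hK.toFinset.card : ℝ) + 1) ≤ E := by
    rintro E ⟨s, ν, h1, h2, -, h4, rfl⟩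
    exact energy_set_bdd d hd K hK s ν h1 h2 h4
  have hin : energy d s ν ∈ S := by
    refine ⟨s, ν, by simp [hs], fun z => ?_, fun z hz => ?_, ?_, rfl⟩
    · exact div_nonneg (Finset.sum_nonneg fun i _ => by split_ifs <;> norm_num) hM0.le
    · simp only [hν]
      rw [Finset.sum_eq_zero, zero_div]
      intro i _
      rw [if_neg]; rintro rfl; exact hz (hmem i)
    · have := hsum (fun _ => 1)
      simp only [one_mul] at this
      rw [this]; simp [hM]
  have hpos : 0 < sInf S := lt_of_lt_of_le (by positivity) (le_csInf ⟨_, hin⟩ hlow)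
  have hle : sInf S ≤ W / M ^ 2 := (csInf_le ⟨_, hlow⟩ hin).trans (by rw [hen]; gcongr)
  have : capacity d K = (sInf S)⁻¹ := rfl
  rw [this, ← inv_div]
  exact inv_anti₀ hpos hle


/-! ### Averages over finite sequences of steps -/

/-- Average of `f` over all sequences of length `m`. -/
noncomputable def Eavg {α : Type} [Fintype α] : ℕ → (List α → ℝ) → ℝ
  | 0, f => f []
  | m+1, f => (∑ a : α, Eavg m (fun l => f (a :: l))) / Fintype.card α

section Eavg
variable {α : Type} [Fintype α]

lemma Eavg_mono : ∀ (m : ℕ) (f g : List α → ℝ), (∀ l, l.length = m → f l ≤ g l) → Eavg m f ≤ Eavg m g := by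
  intro m
  induction m with
  | zero => intro f g h; exact h [] rfl
  | succ m ih =>
    intro f g h
    simp only [Eavg]
    gcongr
    exact ih _ _ fun l hl => h _ (by simp [hl])

lemma Eavg_congr (m : ℕ) (f g : List α → ℝ) (h : ∀ l, l.length = m → f l = g l) : Eavg m f = Eavg m g :=
  le_antisymm (Eavg_mono m f g fun l hl => (h l hl).le) (Eavg_mono m g f fun l hl => (h l hl).ge)

lemma Eavg_const [Nonempty α] (m : ℕ) (c : ℝ) : Eavg (α := α) m (fun _ => c) = c := by
  induction m with
  | zero => rfl
  | succ m ih => simp [Eavg, ih]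

lemma Eavg_mul (m : ℕ) (c : ℝ) : ∀ (f : List α → ℝ), Eavg m (fun l => c * f l) = c * Eavg m f := by
  induction m with
  | zero => intro f; rfl
  | succ m ih => intro f; simp only [Eavg, ih, ← Finset.mul_sum, mul_div_assoc]

lemma Eavg_sum {I : Type*} (s : Finset I) (m : ℕ) : ∀ (f : I → List α → ℝ),
    Eavg m (fun l => ∑ i ∈ s, f i l) = ∑ i ∈ s, Eavg m (f i) := by
  induction m with
  | zero => intro f; rfl
  | succ m ih =>
    intro f
    simp only [Eavg, ih, ← Finset.sum_div]
    rw [Finset.sum_comm]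

lemma Eavg_add (m k : ℕ) : ∀ (f : List α → ℝ),
    Eavg (m + k) f = Eavg m (fun l => Eavg k (fun l' => f (l ++ l'))) := by
  induction m with
  | zero => intro f; simp [Eavg]
  | succ m ih =>
    intro f
    rw [show m + 1 + k = (m + k) + 1 by omega]
    simp only [Eavg, ih, List.cons_append]

lemma Eavg_nonneg (m : ℕ) (f : List α → ℝ) (h : ∀ l, 0 ≤ f l) : 0 ≤ Eavg m f := by
  have := Eavg_mono m (fun l => 0 * f l) f (fun l _ => by simpa using h l)
  rwa [Eavg_mul, zero_mul] at this

open Classical in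
lemma Eavg_markov [Nonempty α] (m : ℕ) (f : List α → ℝ) (h : ∀ l, 0 ≤ f l) (A : ℝ) (hA : 0 < A)
    (hE : Eavg m f ≤ A) : Eavg m (fun l => if 2 * A < f l then 1 else 0) ≤ 1 / 2 := by
  calc _ ≤ Eavg m (fun l => (1 / (2 * A)) * f l) := by
        apply Eavg_mono
        intro l _
        split_ifs with h1
        · rw [one_div, inv_mul_eq_div, le_div_iff₀ (by positivity)]; linarith
        · have := h l; positivity
    _ ≤ 1 / (2 * A) * A := by rw [Eavg_mul]; gcongr
    _ = 1 / 2 := by field_simp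

lemma Eavg_ofFn (m : ℕ) : ∀ (f : List α → ℝ),
    Eavg m f = (∑ ξ : Fin m → α, f (List.ofFn ξ)) / (Fintype.card α : ℝ) ^ m := by
  induction m with
  | zero => intro f; simp [Eavg]
  | succ m ih =>
    intro f
    simp only [Eavg, ih]
    rw [← (Fin.consEquiv (fun _ : Fin (m+1) => α)).sum_comp, Fintype.sum_prod_type, ← Finset.sum_div,
      div_div, pow_succ]
    simp [Fin.consEquiv]

end Eavg

/-! ### Joint walks -/

/-- Sums over product spaces of functions of one coordinate. -/
lemma sum_one_coord {n : ℕ} {β : Type} [Fintype β] (i : Fin n) (h : β → ℝ) :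
    (∑ a : Fin n → β, h (a i)) = (∑ v, h v) * (Fintype.card (Fin n → β)) / Fintype.card β := by
  classical
  rcases isEmpty_or_nonempty β with hβ | hβ
  · have : IsEmpty (Fin n → β) := ⟨fun a => hβ.elim (a i)⟩
    simp
  rw [← (Equiv.funSplitAt i β).symm.sum_comp, ← Fintype.card_congr (Equiv.funSplitAt i β).symm]
  rw [Fintype.sum_prod_type]
  have : (Fintype.card β : ℝ) ≠ 0 := by simp [Fintype.card_ne_zero]
  simp [Equiv.funSplitAt, Equiv.piSplitAt, Fintype.card_prod, ← Finset.mul_sum]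
  field_simp

lemma sum_two_coord {n : ℕ} {β : Type} [Fintype β] (i j : Fin n) (hij : i ≠ j) (h : β → β → ℝ) :
    (∑ a : Fin n → β, h (a i) (a j)) =
      ∑ a : Fin n → β, (∑ v, h v (a j)) / Fintype.card β := by
  classical
  rcases isEmpty_or_nonempty β with hβ | hβ
  · have : IsEmpty (Fin n → β) := ⟨fun a => hβ.elim (a i)⟩
    simp
  rw [← (Equiv.funSplitAt i β).symm.sum_comp, ← (Equiv.funSplitAt i β).symm.sum_comp]
  rw [Fintype.sum_prod_type, Fintype.sum_prod_type]
  have : (Fintype.card β : ℝ) ≠ 0 := by simp [Fintype.card_ne_zero]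
  simp [Equiv.funSplitAt, Equiv.piSplitAt, hij.symm]
  rw [← Finset.sum_div, Finset.sum_comm]
  field_simp

/-- Position of the joint walk at time `t`, started at `z`, with step list `l`. -/
def pos {d n : ℕ} : (Fin n → Zd d) → List (Fin n → St d) → ℕ → (Fin n → Zd d)
  | z, _, 0 => z
  | z, [], _+1 => z
  | z, a :: l, t+1 => pos (fun i => z i + vec (a i)) l t

lemma pos_zero {d n : ℕ} (z : Fin n → Zd d) (l : List (Fin n → St d)) : pos z l 0 = z := by
  cases l <;> rfl

lemma pos_drop {d n : ℕ} (l : List (Fin n → St d)) : ∀ (z : Fin n → Zd d) (o t : ℕ), o ≤ l.length →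
    pos (pos z l o) (l.drop o) t = pos z l (o + t) := by
  induction l with
  | nil => intro z o t h; simp at h; subst h; simp [pos_zero]
  | cons a l ih =>
    intro z o t h
    cases o with
    | zero => simp [pos_zero]
    | succ o =>
      simp only [List.drop_succ_cons, Nat.succ_add, pos]
      exact ih _ _ _ (by simpa using h)

lemma pos_append {d n : ℕ} (l l' : List (Fin n → St d)) : ∀ (z : Fin n → Zd d) (t : ℕ), t ≤ l.length →
    pos z (l ++ l') t = pos z l t := by
  induction l with
  | nil => intro z t h; simp at h; subst h; simp [pos_zero]
  | cons a l ih =>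
    intro z t h
    cases t with
    | zero => simp [pos_zero]
    | succ t => simp only [List.cons_append, pos]; exact ih _ _ (by simpa using h)

lemma card_St (d : ℕ) : (Fintype.card (St d) : ℝ) = 2 * d := by
  simp [St, Fintype.card_prod]; ring

lemma avg_one {d n : ℕ} (hd : 3 ≤ d) (k : ℕ) (w : Zd d) (i : Fin n) :
    (∑ a : Fin n → St d, Gk d k (w + vec (a i))) / Fintype.card (Fin n → St d) = Gk d (k+1) w := by
  have : Nonempty (St d) := ⟨(⟨0, by omega⟩, true)⟩
  rw [sum_one_coord i (fun v => Gk d k (w + vec v)), Gk_rec d hd, card_St]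
  have : (Fintype.card (Fin n → St d) : ℝ) ≠ 0 := by exact_mod_cast Fintype.card_ne_zero
  have : (d : ℝ) ≠ 0 := by have : d ≠ 0 := by omega
                           exact_mod_cast this
  field_simp

lemma avg_two {d n : ℕ} (hd : 3 ≤ d) (k : ℕ) (w : Zd d) (i j : Fin n) (hij : i ≠ j) :
    (∑ a : Fin n → St d, Gk d k (w + vec (a j) - vec (a i))) / Fintype.card (Fin n → St d) = Gk d (k+2) w := by
  rw [sum_two_coord i j hij (fun v v' => Gk d k (w + vec v' - vec v))]
  simp_rw [Gk_rec_sub d hd, card_St]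
  have : (d : ℝ) ≠ 0 := by have : d ≠ 0 := by omega
                           exact_mod_cast this
  have e : ∀ x : ℝ, 2 * (d : ℝ) * x / (2 * d) = x := fun x => by field_simp
  simp_rw [e]
  exact avg_one hd (k+1) w j

lemma E_fixed {d n : ℕ} (hd : 3 ≤ d) (k : ℕ) (b : Zd d) (j : Fin n) : ∀ (m t : ℕ) (z : Fin n → Zd d), t ≤ m →
    Eavg m (fun l => Gk d k (pos z l t j - b)) = Gk d (k + t) (z j - b) := by
  have : Nonempty (St d) := ⟨(⟨0, by omega⟩, true)⟩
  intro m
  induction m with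
  | zero => intro t z ht; obtain rfl : t = 0 := by omega
            simp [pos_zero, Eavg]
  | succ m ih =>
    intro t z ht
    cases t with
    | zero => simp [pos_zero, Eavg_const]
    | succ t =>
      simp only [Eavg, pos]
      simp_rw [ih t _ (by omega : t ≤ m)]
      simp_rw [add_sub_right_comm]
      rw [avg_one hd]; rfl

lemma E_diff {d n : ℕ} (hd : 3 ≤ d) (k : ℕ) (i j : Fin n) (hij : i ≠ j) : ∀ (m s t : ℕ) (z : Fin n → Zd d), s ≤ m → t ≤ m →
    Eavg m (fun l => Gk d k (pos z l t j - pos z l s i)) = Gk d (k + s + t) (z j - z i) := by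
  intro m
  induction m with
  | zero => intro s t z hs ht; obtain rfl : t = 0 := by omega
            obtain rfl : s = 0 := by omega
            simp [pos_zero, Eavg]
  | succ m ih =>
    intro s t z hs ht
    cases s with
    | zero => simp only [pos_zero, add_zero]; exact E_fixed hd k (z i) j (m+1) t z ht
    | succ s =>
      cases t with
      | zero =>
        simp only [pos_zero]
        have e : ∀ l, Gk d k (z j - pos z l (s+1) i) = Gk d k (pos z l (s+1) i - z j) := fun l => by
          rw [← Gk_neg d hd, neg_sub]
        simp_rw [e]
        rw [E_fixed hd k (z j) i (m+1) (s+1) z hs, ← Gk_neg d hd, neg_sub, add_zero]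
      | succ t =>
        simp only [Eavg, pos]
        simp_rw [ih s t _ (by omega : s ≤ m) (by omega : t ≤ m)]
        have e : ∀ a : Fin n → St d, z j + vec (a j) - (z i + vec (a i)) = (z j - z i) + vec (a j) - vec (a i) :=
          fun a => by abel
        simp_rw [e]
        rw [avg_two hd _ _ i j hij]
        congr 1; omega

lemma E_same {d n : ℕ} (hd : 3 ≤ d) (k : ℕ) (i : Fin n) : ∀ (m s t : ℕ) (z : Fin n → Zd d), s ≤ t → t ≤ m →
    Eavg m (fun l => Gk d k (pos z l t i - pos z l s i)) = Gk d (k + (t - s)) 0 := by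
  have : Nonempty (St d) := ⟨(⟨0, by omega⟩, true)⟩
  intro m
  induction m with
  | zero => intro s t z hs ht; obtain rfl : t = 0 := by omega
            obtain rfl : s = 0 := by omega
            simp [pos_zero, Eavg]
  | succ m ih =>
    intro s t z hs ht
    cases s with
    | zero => 
      simp only [pos_zero]
      rw [E_fixed hd k (z i) i (m+1) t z ht]; simp
    | succ s =>
      cases t with
      | zero => omega
      | succ t =>
        simp only [Eavg, pos]
        simp_rw [ih s t _ (by omega : s ≤ t) (by omega : t ≤ m)]
        have : (Fintype.card (Fin n → St d) : ℝ) ≠ 0 := by exact_mod_cast Fintype.card_ne_zero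
        rw [Finset.sum_const, Finset.card_univ, nsmul_eq_mul, mul_div_cancel_left₀ _ this, Nat.add_sub_add_right]

lemma E_same' {d n : ℕ} (hd : 3 ≤ d) (i : Fin n) (m s t : ℕ) (z : Fin n → Zd d) (hs : s ≤ m) (ht : t ≤ m) :
    Eavg m (fun l => green d (pos z l s i) (pos z l t i)) = Gk d ((t - s) + (s - t)) 0 := by
  simp_rw [green_eq d hd]
  rcases le_total s t with h | h
  · rw [E_same hd 0 i m s t z h ht]; congr 1; omega
  · have e : ∀ l, Gk d 0 (pos z l t i - pos z l s i) = Gk d 0 (pos z l s i - pos z l t i) := fun l => by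
      rw [← Gk_neg d hd, neg_sub]
    simp_rw [e]
    rw [E_same hd 0 i m t s z h hs]; congr 1; omega



/-! ### One block -/

lemma inv_sqrt_tele (a : ℝ) (ha : 0 ≤ a) : (√(a+1))⁻¹ ≤ 2 * (√(a+1) - √a) := by
  have hq : 0 < √(a+1) := Real.sqrt_pos.mpr (by linarith)
  have h1 : √a ^ 2 = a := Real.sq_sqrt ha
  have h2 : √(a+1) ^ 2 = a + 1 := Real.sq_sqrt (by linarith)
  have h3 : √a ≤ √(a+1) := Real.sqrt_le_sqrt (by linarith)
  rw [inv_le_iff_one_le_mul₀ hq]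
  nlinarith [sq_nonneg (√(a+1) - √a)]

lemma sum_inv_sqrt (m s : ℕ) (hs : s ≤ m) :
    ∑ t ∈ Finset.range m, (√((((t - s) + (s - t) : ℕ) : ℝ) + 1))⁻¹ ≤ 4 * √m := by
  set h : ℕ → ℝ := fun t => √((t : ℝ) - s) - √((s : ℝ) - t) with hh
  have key : ∀ t, (√((((t - s) + (s - t) : ℕ) : ℝ) + 1))⁻¹ ≤ 2 * (h (t+1) - h t) := by
    intro t
    rcases le_or_gt s t with hst | hst
    · obtain ⟨k, rfl⟩ := Nat.exists_eq_add_of_le hst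
      have := inv_sqrt_tele k (by positivity)
      have e1 : (s + k - s) + (s - (s + k)) = k := by omega
      rw [e1]
      simp only [hh]; push_cast
      rw [Real.sqrt_eq_zero_of_nonpos (by linarith [Nat.cast_nonneg (α := ℝ) k] : (s : ℝ) - (s + k) ≤ 0),
        Real.sqrt_eq_zero_of_nonpos (by linarith [Nat.cast_nonneg (α := ℝ) k] : (s : ℝ) - (s + k + 1) ≤ 0),
        show (s : ℝ) + k + 1 - s = k + 1 by ring, show (s : ℝ) + k - s = k by ring]
      linarith
    · obtain ⟨k, rfl⟩ := Nat.exists_eq_add_of_lt hst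
      have := inv_sqrt_tele k (by positivity)
      have e1 : (t - (t + k + 1)) + (t + k + 1 - t) = k + 1 := by omega
      rw [e1]
      have h2 : (√(((k + 1 : ℕ) : ℝ) + 1))⁻¹ ≤ (√((k : ℝ)+1))⁻¹ := by
        apply inv_anti₀ (Real.sqrt_pos.mpr (by positivity))
        apply Real.sqrt_le_sqrt; push_cast; linarith
      simp only [hh]; push_cast at h2 ⊢
      rw [Real.sqrt_eq_zero_of_nonpos (by linarith [Nat.cast_nonneg (α := ℝ) k] : (t : ℝ) + 1 - (t + k + 1) ≤ 0),
        Real.sqrt_eq_zero_of_nonpos (by linarith [Nat.cast_nonneg (α := ℝ) k] : (t : ℝ) - (t + k + 1) ≤ 0),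
        show (t : ℝ) + k + 1 - (t + 1) = k by ring, show (t : ℝ) + k + 1 - t = k + 1 by ring]
      linarith
  calc _ ≤ ∑ t ∈ Finset.range m, 2 * (h (t+1) - h t) := Finset.sum_le_sum fun t _ => key t
    _ = 2 * (h m - h 0) := by rw [← Finset.mul_sum, Finset.sum_range_sub]
    _ ≤ 4 * √m := by
      simp only [hh]
      have hs' : (s : ℝ) ≤ m := by exact_mod_cast hs
      have h0 : (0 : ℝ) ≤ s := by positivity
      rw [Real.sqrt_eq_zero_of_nonpos (by linarith : (s : ℝ) - m ≤ 0),
        Real.sqrt_eq_zero_of_nonpos (by push_cast; linarith : ((0 : ℕ) : ℝ) - s ≤ 0)]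
      have h1 : √((m : ℝ) - s) ≤ √m := Real.sqrt_le_sqrt (by linarith)
      have h2 : √((s : ℝ) - (0 : ℕ)) ≤ √m := Real.sqrt_le_sqrt (by push_cast; linarith)
      linarith

/-- Total interaction in a block. -/
noncomputable def blkS (d n m : ℕ) (z : Fin n → Zd d) (l : List (Fin n → St d)) : ℝ :=
  ∑ p : Fin n × Fin m, ∑ q : Fin n × Fin m,
    green d (pos z l (m + 1 + p.2) p.1) (pos z l (m + 1 + q.2) q.1)

lemma blkS_nonneg (d n m : ℕ) (z : Fin n → Zd d) (l : List (Fin n → St d)) : 0 ≤ blkS d n m z l :=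
  Finset.sum_nonneg fun _ _ => Finset.sum_nonneg fun _ _ => green_nonneg _ _ _

lemma rpow_le_inv_sqrt (d : ℕ) (hd : 3 ≤ d) (x : ℝ) (hx : 1 ≤ x) : x ^ (-((d : ℝ) - 2) / 2) ≤ (√x)⁻¹ := by
  have hd3 : (3 : ℝ) ≤ d := by exact_mod_cast hd
  rw [Real.sqrt_eq_rpow, ← Real.rpow_neg (by linarith)]
  apply Real.rpow_le_rpow_of_exponent_le hx
  linarith

lemma blkS_avg (d : ℕ) (hd : 3 ≤ d) : ∃ C : ℝ, 0 < C ∧ ∀ (n m : ℕ), 0 < n → 0 < m → ∀ z : Fin n → Zd d,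
    Eavg (2 * m) (blkS d n m z) ≤ C * (n * m : ℝ) ^ 2 * (1 / (m : ℝ) ^ (((d : ℝ) - 2) / 2) + 4 / (n * √m)) := by
  classical
  obtain ⟨C, hC, hG⟩ := Gk_bound d hd
  have hd3 : (3 : ℝ) ≤ d := by exact_mod_cast hd
  refine ⟨C, hC, fun n m hn hm z => ?_⟩
  have hm' : (0 : ℝ) < m := by positivity
  have hn' : (0 : ℝ) < n := by positivity
  set e : ℝ := ((d : ℝ) - 2) / 2 with he
  unfold blkS
  simp_rw [Eavg_sum]
  have key : ∀ p q : Fin n × Fin m,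
      Eavg (2 * m) (fun l => green d (pos z l (m + 1 + p.2) p.1) (pos z l (m + 1 + q.2) q.1)) ≤
        C * (1 / (m : ℝ) ^ e) + (if p.1 = q.1 then C * (√((((q.2 - p.2) + (p.2 - q.2) : ℕ) : ℝ) + 1))⁻¹ else 0) := by
    rintro ⟨i, s⟩ ⟨j, t⟩
    have hs := s.isLt
    have ht := t.isLt
    simp only
    split_ifs with hij
    · subst hij
      rw [E_same' hd i (2 * m) _ _ z (by omega) (by omega)]
      have h1 := hG ((m + 1 + t - (m + 1 + s)) + (m + 1 + s - (m + 1 + t))) 0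
      have e1 : ((m + 1 + t - (m + 1 + s)) + (m + 1 + s - (m + 1 + t)) : ℕ) = ((t : ℕ) - s) + (s - t) := by omega
      rw [e1] at h1 ⊢
      have h2 := rpow_le_inv_sqrt d hd (((((t : ℕ) - s) + (s - t) : ℕ) : ℝ) + 1) (by simp only [le_add_iff_nonneg_left]; positivity)
      have h3 := mul_le_mul_of_nonneg_left h2 hC.le
      have h4 : 0 < C * (1 / (m : ℝ) ^ e) := by positivity
      linarith
    · simp_rw [green_eq d hd]
      rw [E_diff hd 0 i j hij (2 * m) _ _ z (by omega) (by omega), add_zero]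
      refine (hG _ _).trans ?_
      gcongr
      rw [show -((d : ℝ) - 2) / 2 = -e by rw [he]; ring, Real.rpow_neg (by positivity), one_div]
      apply inv_anti₀ (by positivity)
      apply Real.rpow_le_rpow hm'.le _ (by rw [he]; linarith)
      push_cast
      have : (0 : ℝ) ≤ s := by positivity
      have : (0 : ℝ) ≤ t := by positivity
      linarith
  calc _ ≤ ∑ p : Fin n × Fin m, ∑ q : Fin n × Fin m, (C * (1 / (m : ℝ) ^ e) +
        (if p.1 = q.1 then C * (√((((q.2 - p.2) + (p.2 - q.2) : ℕ) : ℝ) + 1))⁻¹ else 0)) :=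
        Finset.sum_le_sum fun p _ => Finset.sum_le_sum fun q _ => key p q
    _ ≤ ∑ p : Fin n × Fin m, ((n * m) * (C * (1 / (m : ℝ) ^ e)) + C * (4 * √m)) := by
        refine Finset.sum_le_sum fun p _ => ?_
        rw [Finset.sum_add_distrib]
        apply add_le_add
        · simp [Fintype.card_prod]
        · rw [Fintype.sum_prod_type]
          simp only
          rw [Finset.sum_comm]
          simp only [Finset.sum_ite_eq, Finset.mem_univ, if_true]
          rw [← Finset.mul_sum]
          gcongr
          have := sum_inv_sqrt m p.2 p.2.isLt.le
          rwa [← Fin.sum_univ_eq_sum_range (fun t => (√((((t - p.2) + (p.2 - t) : ℕ) : ℝ) + 1))⁻¹)] at this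
    _ = _ := by
        rw [Finset.sum_const, Finset.card_univ, Fintype.card_prod, Fintype.card_fin, Fintype.card_fin, nsmul_eq_mul]
        push_cast
        have hsq : √(m : ℝ) * √m = m := Real.mul_self_sqrt hm'.le
        have hsp : 0 < √(m : ℝ) := Real.sqrt_pos.mpr hm'
        have : (n * m : ℝ) ^ 2 * (4 / (n * √m)) = (n * m) * (4 * √m) := by
          field_simp
          rw [pow_two (√(m:ℝ)), hsq]
        rw [mul_assoc C, mul_add ((n * m : ℝ) ^ 2), this]
        ring

/-! ### Many blocks -/

def allBad {d n : ℕ} (W : ℝ) (m : ℕ) : ℕ → (Fin n → Zd d) → List (Fin n → St d) → Prop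
  | 0, _, _ => True
  | B+1, z, l => W < blkS d n m z l ∧ allBad W m B (pos z l (2*m)) (l.drop (2*m))

lemma blkS_append {d n m : ℕ} (z : Fin n → Zd d) (l l' : List (Fin n → St d)) (hl : l.length = 2 * m) :
    blkS d n m z (l ++ l') = blkS d n m z l := by
  unfold blkS
  refine Finset.sum_congr rfl fun p _ => Finset.sum_congr rfl fun q _ => ?_
  have hp := p.2.isLt
  have hq := q.2.isLt
  rw [pos_append _ _ _ _ (by omega), pos_append _ _ _ _ (by omega)]

open Classical in
lemma allBad_prob {d n m : ℕ} (hd : 3 ≤ d) (A : ℝ) (hA : 0 < A)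
    (hE : ∀ z : Fin n → Zd d, Eavg (2 * m) (blkS d n m z) ≤ A) (R : ℕ) : ∀ (B : ℕ) (z : Fin n → Zd d),
    Eavg (2 * m * B + R) (fun l => if allBad (2 * A) m B z l then 1 else 0) ≤ (1 / 2) ^ B := by
  have : Nonempty (St d) := ⟨(⟨0, by omega⟩, true)⟩
  intro B
  induction B with
  | zero => intro z; simp [allBad, Eavg_const]
  | succ B ih =>
    intro z
    rw [show 2 * m * (B + 1) + R = 2 * m + (2 * m * B + R) by ring, Eavg_add]
    calc _ ≤ Eavg (2 * m) (fun l => (1 / 2) ^ B * (if 2 * A < blkS d n m z l then 1 else 0)) := by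
          apply Eavg_mono
          intro l hl
          have e : ∀ l' , (if allBad (2 * A) m (B+1) z (l ++ l') then (1:ℝ) else 0) =
              (if 2 * A < blkS d n m z l then 1 else 0) *
                (if allBad (2 * A) m B (pos z l (2*m)) l' then 1 else 0) := by
            intro l'
            simp only [allBad, blkS_append z l l' hl, pos_append l l' z (2*m) hl.ge]
            rw [List.drop_append_of_le_length hl.ge, List.drop_of_length_le hl.le, List.nil_append]
            split_ifs <;> simp_all
          simp_rw [e]
          rw [Eavg_mul, mul_comm]
          apply mul_le_mul_of_nonneg_right (ih _)
          split_ifs <;> norm_num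
      _ ≤ _ := by
          rw [Eavg_mul, pow_succ]
          gcongr
          exact Eavg_markov (2 * m) _ (blkS_nonneg d n m z) A hA (hE z)

lemma not_allBad {d n m : ℕ} (W : ℝ) : ∀ (B : ℕ) (z : Fin n → Zd d) (l : List (Fin n → St d)),
    2 * m * B ≤ l.length → ¬ allBad W m B z l →
    ∃ o, o + 2 * m ≤ l.length ∧ blkS d n m (pos z l o) (l.drop o) ≤ W := by
  intro B
  induction B with
  | zero => intro z l _ h; exact absurd trivial h
  | succ B ih =>
    intro z l hl h
    have hl' : 2 * m * B + 2 * m ≤ l.length := by rw [← Nat.mul_succ]; exact hl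
    have h0 : 0 ≤ 2 * m * B := Nat.zero_le _
    by_cases hb : W < blkS d n m z l
    · have h2 : ¬ allBad W m B (pos z l (2*m)) (l.drop (2*m)) := fun hh => h ⟨hb, hh⟩
      obtain ⟨o, ho, h3⟩ := ih _ _ (by rw [List.length_drop]; omega) h2
      rw [List.length_drop] at ho
      refine ⟨2 * m + o, by omega, ?_⟩
      rw [pos_drop _ _ _ _ (by omega), List.drop_drop] at h3
      exact h3
    · exact ⟨0, by omega, by simpa [pos_zero] using not_lt.mp hb⟩

/-- Range of the joint walk at times `1, …, T`. -/
def rangeSet {d n : ℕ} (T : ℕ) (z : Fin n → Zd d) (l : List (Fin n → St d)) : Set (Zd d) :=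
  {y | ∃ k : Fin n, ∃ t, 1 ≤ t ∧ t ≤ T ∧ pos z l t k = y}

lemma rangeSet_finite {d n : ℕ} (T : ℕ) (z : Fin n → Zd d) (l : List (Fin n → St d)) :
    (rangeSet T z l).Finite := by
  apply (Set.finite_range (fun p : Fin n × Fin (T+1) => pos z l p.2 p.1)).subset
  rintro y ⟨k, t, -, h2, rfl⟩
  exact ⟨(k, ⟨t, by omega⟩), rfl⟩

open Classical in
lemma range_prob (d : ℕ) (hd : 3 ≤ d) : ∃ c : ℝ, 0 < c ∧ ∀ (n m B T : ℕ), 0 < n → 0 < m → 2 * m * B ≤ T →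
    ∀ z : Fin n → Zd d,
    Eavg T (fun l => if capacity d (rangeSet T z l) < c * min (n * √m) ((m : ℝ) ^ (((d : ℝ) - 2) / 2)) then 1 else 0)
      ≤ (1 / 2) ^ B := by
  obtain ⟨C, hC, hE⟩ := blkS_avg d hd
  refine ⟨1 / (10 * C), by positivity, fun n m B T hn hm hT z => ?_⟩
  have hm' : (0 : ℝ) < m := by positivity
  have hn' : (0 : ℝ) < n := by positivity
  have : Nonempty (Fin n × Fin m) := ⟨(⟨0, hn⟩, ⟨0, hm⟩)⟩
  set x : ℝ := (m : ℝ) ^ (((d : ℝ) - 2) / 2) with hx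
  have hx0 : 0 < x := by positivity
  have hsp : 0 < √(m : ℝ) := Real.sqrt_pos.mpr hm'
  set y : ℝ := n * √m with hy
  have hy0 : 0 < y := by positivity
  set A := C * (n * m : ℝ) ^ 2 * (1 / x + 4 / y) with hA
  have hA0 : 0 < A := by positivity
  obtain ⟨R, rfl⟩ := Nat.exists_eq_add_of_le hT
  refine le_trans ?_ (allBad_prob hd A hA0 (fun z => hE n m hn hm z) R B z)
  apply Eavg_mono
  intro l hl
  by_cases hb : allBad (2 * A) m B z l
  · simp only [hb, if_true]; split_ifs <;> norm_num
  · simp only [hb, if_false]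
    rw [if_neg]
    rw [not_lt]
    obtain ⟨o, ho, hS⟩ := not_allBad (2 * A) B z l (by omega) hb
    have := capacity_ge d hd (rangeSet (2 * m * B + R) z l) (rangeSet_finite _ z l)
      (fun p : Fin n × Fin m => pos (pos z l o) (l.drop o) (m + 1 + p.2) p.1) (by
        rintro ⟨k, s⟩
        have := s.isLt
        simp only
        rw [pos_drop _ _ _ _ (by omega)]
        exact ⟨k, o + (m + 1 + s), by omega, by omega, rfl⟩) (2 * A) hS
    refine le_trans ?_ this
    rw [Fintype.card_prod, Fintype.card_fin, Fintype.card_fin, Nat.cast_mul, le_div_iff₀ (by positivity), hA]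
    have h1 : min y x * (1 / x + 4 / y) ≤ 5 := by
      have h2 : min y x * (1 / x) ≤ 1 := by
        rw [mul_one_div, div_le_one hx0]; exact min_le_right _ _
      have h3 : min y x * (1 / y) ≤ 1 := by
        rw [mul_one_div, div_le_one hy0]; exact min_le_left _ _
      calc _ = min y x * (1 / x) + 4 * (min y x * (1 / y)) := by ring
        _ ≤ 5 := by linarith
    have h4 : 1 / (10 * C) * min y x * (2 * (C * (n * m : ℝ) ^ 2 * (1 / x + 4 / y))) =
        (n * m : ℝ) ^ 2 * (min y x * (1 / x + 4 / y)) / 5 := by field_simp; ring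
    rw [h4]
    have : (0:ℝ) ≤ (n * m : ℝ) ^ 2 := by positivity
    nlinarith


/-! ### From path laws to measures -/

lemma isStep_vec {d : ℕ} {x y : Zd d} (h : IsStep x y) : ∃ v : St d, y = x + vec v := by
  unfold IsStep at h
  obtain ⟨j, hj⟩ : ∃ j, (y j - x j).natAbs ≠ 0 := by
    by_contra hh
    push Not at hh
    simp [hh] at h
  have hsum := Finset.add_sum_erase Finset.univ (fun j => (y j - x j).natAbs) (Finset.mem_univ j)
  beta_reduce at hsum
  rw [h] at hsum
  have h1 : (y j - x j).natAbs = 1 := by omega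
  have h2 : ∑ i ∈ Finset.univ.erase j, (y i - x i).natAbs = 0 := by omega
  have h3 : ∀ i, i ≠ j → y i = x i := by
    intro i hi
    have := (Finset.sum_eq_zero_iff.mp h2) i (by simp [hi])
    omega
  rcases Int.natAbs_eq (y j - x j) with h4 | h4
  · refine ⟨(j, true), ?_⟩
    ext i
    by_cases hi : i = j
    · subst hi; simp [vec]; omega
    · simp [vec, hi, h3 i hi]
  · refine ⟨(j, false), ?_⟩
    ext i
    by_cases hi : i = j
    · subst hi; simp [vec]; omega
    · simp [vec, hi, h3 i hi]

lemma path_exists {d n : ℕ} : ∀ (T : ℕ) (w : ℕ → Fin n → Zd d),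
    (∀ k, ∀ t < T, IsStep (w t k) (w (t+1) k)) →
    ∃ l : List (Fin n → St d), l.length = T ∧ ∀ t ≤ T, pos (w 0) l t = w t := by
  intro T
  induction T with
  | zero => intro w _; exact ⟨[], rfl, fun t ht => by obtain rfl : t = 0 := by omega
                                                      simp [pos_zero]⟩
  | succ T ih =>
    intro w hw
    obtain ⟨l, hl, h⟩ := ih (fun t => w (t+1)) (fun k t ht => hw k (t+1) (by omega))
    choose a ha using fun k => isStep_vec (hw k 0 (by omega))
    refine ⟨a :: l, by simp [hl], fun t ht => ?_⟩
    cases t with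
    | zero => rfl
    | succ t =>
      simp only [pos]
      rw [← h t (by omega)]
      congr 1
      ext1 k
      exact (ha k).symm

lemma tsum_pi_pow {β : Type} (ν : β → ℝ≥0∞) : ∀ n : ℕ, ∑' z : Fin n → β, ∏ k, ν (z k) = (∑' y, ν y) ^ n := by
  intro n
  induction n with
  | zero => simp
  | succ n ih =>
    rw [← (Fin.consEquiv (fun _ : Fin (n+1) => β)).tsum_eq, ENNReal.tsum_prod']
    simp only [Fin.consEquiv, Equiv.coe_fn_mk, Fin.prod_univ_succ, Fin.cons_zero, Fin.cons_succ]
    simp_rw [ENNReal.tsum_mul_left, ih, ENNReal.tsum_mul_right]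
    rw [pow_succ, mul_comm]

open Classical in
lemma link (d : ℕ) (hd : 3 ≤ d) (n T : ℕ) {Ω : Type} [MeasurableSpace Ω] (P : Measure Ω) (A : Set Ω)
    (Y : Fin n → ℕ → Ω → Zd d) (ν : Zd d → ℝ≥0∞) (M : ℝ≥0∞) (hν : ∑' z, ν z ≤ 1)
    (h0 : ∀ w : Fin n → ℕ → Zd d, (¬ ∀ k, ∀ t < T, IsStep (w k t) (w k (t+1))) →
      P (A ∩ {ω | ∀ k, ∀ t ≤ T, Y k t ω = w k t}) = 0)
    (h1 : ∀ w : Fin n → ℕ → Zd d, P (A ∩ {ω | ∀ k, ∀ t ≤ T, Y k t ω = w k t}) ≤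
      M * ∏ k, (ν (w k 0) * ENNReal.ofReal (((2 * (d : ℝ))⁻¹) ^ T)))
    (Bad : Set (Zd d) → Prop) (p : ℝ)
    (hbad : ∀ z : Fin n → Zd d, Eavg T (fun l => if Bad (rangeSet T z l) then 1 else 0) ≤ p) :
    P (A ∩ {ω | Bad {y | ∃ k : Fin n, ∃ t, 1 ≤ t ∧ t ≤ T ∧ Y k t ω = y}}) ≤ M * ENNReal.ofReal p := by
  let ext : (Fin n → Fin (T+1) → Zd d) → Fin n → ℕ → Zd d := fun w k t => w k ⟨min t T, by omega⟩
  let U0 : Set Ω := ⋃ w : {w : Fin n → Fin (T+1) → Zd d // ¬ ∀ k, ∀ t < T, IsStep (ext w k t) (ext w k (t+1))},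
    A ∩ {ω | ∀ k, ∀ t ≤ T, Y k t ω = ext w.1 k t}
  let V : (Fin n → Zd d) → (Fin T → Fin n → St d) → Set Ω := fun z ξ =>
    if Bad (rangeSet T z (List.ofFn ξ)) then A ∩ {ω | ∀ k, ∀ t ≤ T, Y k t ω = pos z (List.ofFn ξ) t k} else ∅
  let U1 : Set Ω := ⋃ z, ⋃ ξ, V z ξ
  have hsub : A ∩ {ω | Bad {y | ∃ k : Fin n, ∃ t, 1 ≤ t ∧ t ≤ T ∧ Y k t ω = y}} ⊆ U0 ∪ U1 := by
    rintro ω ⟨hA, hB⟩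
    by_cases hs : ∀ k, ∀ t < T, IsStep (Y k t ω) (Y k (t+1) ω)
    · right
      obtain ⟨l, hl, hl2⟩ := path_exists T (fun t k => Y k t ω) hs
      obtain ⟨ξ, rfl⟩ : ∃ ξ : Fin T → Fin n → St d, List.ofFn ξ = l := by
        subst hl; exact ⟨l.get, List.ofFn_get l⟩
      refine Set.mem_iUnion.mpr ⟨fun k => Y k 0 ω, Set.mem_iUnion.mpr ⟨ξ, ?_⟩⟩
      have hr : rangeSet T (fun k => Y k 0 ω) (List.ofFn ξ) = {y | ∃ k : Fin n, ∃ t, 1 ≤ t ∧ t ≤ T ∧ Y k t ω = y} := by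
        ext y
        constructor
        · rintro ⟨k, t, ht1, ht2, rfl⟩
          exact ⟨k, t, ht1, ht2, (congrFun (hl2 t ht2) k).symm⟩
        · rintro ⟨k, t, ht1, ht2, rfl⟩
          exact ⟨k, t, ht1, ht2, congrFun (hl2 t ht2) k⟩
      simp only [V]
      rw [if_pos (by rw [hr]; exact hB)]
      exact ⟨hA, fun k t ht => (congrFun (hl2 t ht) k).symm⟩
    · left
      have he : ∀ k, ∀ t ≤ T, ext (fun k t => Y k t ω) k t = Y k t ω := by
        intro k t ht; simp only [ext, min_eq_left ht]
      refine Set.mem_iUnion.mpr ⟨⟨fun k t => Y k t ω, ?_⟩, hA, fun k t ht => (he k t ht).symm⟩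
      intro hh
      apply hs
      intro k t ht
      have := hh k t ht
      rwa [he k t ht.le, he k (t+1) ht] at this
  have hU0 : P U0 = 0 := by
    rw [measure_iUnion_null_iff]
    rintro ⟨w, hw⟩
    exact h0 _ hw
  have hU1 : P U1 ≤ M * ENNReal.ofReal p := by
    have hz : ∀ z, P (⋃ ξ, V z ξ) ≤ M * (∏ k, ν (z k)) * ENNReal.ofReal p := by
      intro z
      have hV : ∀ ξ, P (V z ξ) ≤ M * (∏ k, ν (z k)) *
          ENNReal.ofReal ((if Bad (rangeSet T z (List.ofFn ξ)) then 1 else 0) / (Fintype.card (Fin n → St d) : ℝ) ^ T) := by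
        intro ξ
        simp only [V]
        split_ifs with hB
        · refine (h1 (fun k t => pos z (List.ofFn ξ) t k)).trans (le_of_eq ?_)
          simp only [pos_zero]
          rw [Finset.prod_mul_distrib, Finset.prod_const, Finset.card_univ, Fintype.card_fin, mul_assoc,
            ← ENNReal.ofReal_pow (by positivity)]
          congr 3
          rw [Fintype.card_fun, Fintype.card_fin]
          push_cast
          rw [card_St, one_div, inv_pow, inv_pow, ← pow_mul, ← pow_mul, Nat.mul_comm T n]
        · simp
      calc P (⋃ ξ, V z ξ) ≤ ∑ ξ, P (V z ξ) := measure_iUnion_fintype_le _ _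
        _ ≤ ∑ ξ, M * (∏ k, ν (z k)) * ENNReal.ofReal ((if Bad (rangeSet T z (List.ofFn ξ)) then 1 else 0) / (Fintype.card (Fin n → St d) : ℝ) ^ T) :=
          Finset.sum_le_sum fun ξ _ => hV ξ
        _ = M * (∏ k, ν (z k)) * ENNReal.ofReal (Eavg T (fun l => if Bad (rangeSet T z l) then 1 else 0)) := by
          rw [← Finset.mul_sum, ← ENNReal.ofReal_sum_of_nonneg, Eavg_ofFn, Finset.sum_div]
          intro ξ _
          split_ifs <;> positivity
        _ ≤ _ := by gcongr; exact hbad z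
    calc P U1 ≤ ∑' z, P (⋃ ξ, V z ξ) := measure_iUnion_le _
      _ ≤ ∑' z : Fin n → Zd d, M * (∏ k, ν (z k)) * ENNReal.ofReal p := ENNReal.tsum_le_tsum hz
      _ = M * (∑' z, ν z) ^ n * ENNReal.ofReal p := by
        rw [ENNReal.tsum_mul_right, ENNReal.tsum_mul_left, tsum_pi_pow]
      _ ≤ M * 1 * ENNReal.ofReal p := by
        gcongr
        exact pow_le_one₀ (by simp) hν
      _ = _ := by rw [mul_one]
  calc _ ≤ P (U0 ∪ U1) := measure_mono hsub
    _ ≤ P U0 + P U1 := measure_union_le _ _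
    _ ≤ _ := by rw [hU0, zero_add]; exact hU1


/-! ### One level of the recursion -/

lemma escProb_nonneg (d : ℕ) (A : Set (Zd d)) : ∀ n z, 0 ≤ escProb d A n z := by
  intro n
  induction n with
  | zero => intro z; simp [escProb]
  | succ n ih =>
    intro z
    simp only [escProb]
    refine div_nonneg (Finset.sum_nonneg fun j _ => add_nonneg ?_ ?_) (by positivity)
    · split_ifs
      · exact le_rfl
      · exact ih _
    · split_ifs
      · exact le_rfl
      · exact ih _

lemma capacity_nonneg' (d : ℕ) (A : Set (Zd d)) : 0 ≤ capacity d A := by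
  unfold capacity
  refine inv_nonneg.mpr (Real.sInf_nonneg ?_)
  rintro E ⟨s, ν, -, h, -, -, rfl⟩
  unfold energy
  exact Finset.sum_nonneg fun z _ => Finset.sum_nonneg fun w _ =>
    mul_nonneg (mul_nonneg (green_nonneg _ _ _) (h z)) (h w)

lemma neq_nonneg (d : ℕ) (A : Set (Zd d)) (z) : 0 ≤ neqMeasure d A z := by
  unfold neqMeasure eqMeasure
  refine div_nonneg ?_ (capacity_nonneg' d A)
  split_ifs
  · exact Real.iInf_nonneg fun n => escProb_nonneg d A n z
  · exact le_rfl

lemma pathProb_nonneg (d : ℕ) (A : Set (Zd d)) (m w) : 0 ≤ pathProb d (neqMeasure d A) m w := by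
  unfold pathProb
  split_ifs
  · exact mul_nonneg (neq_nonneg _ _ _) (by positivity)
  · exact le_rfl

lemma tsum_exp_ofReal (a x : ℝ) (hx : 0 ≤ x) (ha : 0 ≤ a) :
    ∑' n : ℕ, ENNReal.ofReal (a * x ^ n / n.factorial) = ENNReal.ofReal (a * Real.exp x) := by
  have h : HasSum (fun n : ℕ => a * x ^ n / n.factorial) (a * Real.exp x) := by
    have := (NormedSpace.expSeries_div_hasSum_exp (𝔸 := ℝ) x).mul_left a
    rw [← Real.exp_eq_exp_ℝ] at this
    simpa only [mul_div_assoc] using this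
  rw [← ENNReal.ofReal_tsum_of_nonneg (fun n => by positivity) h.summable, h.tsum_eq]

lemma tsum_poisson (lam : ℝ) (h : 0 ≤ lam) : ∑' n : ℕ, ENNReal.ofReal (poissonProb lam n) = 1 := by
  unfold poissonProb
  rw [tsum_exp_ofReal _ _ h (by positivity), ← Real.exp_add]; simp

lemma poisson_nonneg (lam : ℝ) (h : 0 ≤ lam) (n) : 0 ≤ poissonProb lam n := by
  unfold poissonProb; positivity

lemma exp_neg_one_le : Real.exp (-1) ≤ 1/2 := by
  rw [Real.exp_neg, one_div]
  apply inv_anti₀ (by norm_num)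
  have := Real.add_one_le_exp (1:ℝ)
  linarith

lemma chernoff (lam : ℝ) (h : 0 ≤ lam) :
    ∑' n : ℕ, (if (n:ℝ) ≤ lam/4 then ENNReal.ofReal (poissonProb lam n) else 0) ≤ ENNReal.ofReal (Real.exp (-(lam/4))) := by
  calc _ ≤ ∑' n : ℕ, ENNReal.ofReal ((Real.exp (lam/4) * Real.exp (-lam)) * (lam * Real.exp (-1)) ^ n / n.factorial) := by
        refine ENNReal.tsum_le_tsum fun n => ?_
        split_ifs with hn
        · apply ENNReal.ofReal_le_ofReal
          have h1 : 1 ≤ Real.exp (lam/4) * Real.exp (-1) ^ n := by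
            rw [← Real.exp_nat_mul, ← Real.exp_add]
            apply Real.one_le_exp
            linarith
          have h2 := poisson_nonneg lam h n
          calc poissonProb lam n ≤ poissonProb lam n * (Real.exp (lam/4) * Real.exp (-1) ^ n) := le_mul_of_one_le_right h2 h1
            _ = _ := by unfold poissonProb; rw [mul_pow]; ring
        · simp
    _ = ENNReal.ofReal ((Real.exp (lam/4) * Real.exp (-lam)) * Real.exp (lam * Real.exp (-1))) :=
        tsum_exp_ofReal _ _ (by positivity) (by positivity)
    _ ≤ _ := by
        apply ENNReal.ofReal_le_ofReal
        rw [← Real.exp_add, ← Real.exp_add]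
        apply Real.exp_le_exp.mpr
        have := mul_le_mul_of_nonneg_left exp_neg_one_le h
        linarith

/-- the total mass of the starting law is at most one -/
lemma start_mass (d : ℕ) (u : ℝ) {Ω : Type} [MeasurableSpace Ω] (P : Measure Ω) [IsProbabilityMeasure P]
    (K : Set (Zd d)) (N : Ω → ℕ) (Y : ℕ → ℕ → Ω → Zd d) (h : HasLevelLaw d u P K N Y)
    (hl : 0 < u * capacity d K) : ∑' z, ENNReal.ofReal (neqMeasure d K z) ≤ 1 := by
  obtain ⟨hY, hN, hlaw⟩ := h
  set lam := u * capacity d K with hlam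
  set S := ∑' z, ENNReal.ofReal (neqMeasure d K z) with hS
  by_contra hcon
  push Not at hcon
  let E : (Σ n : ℕ, Fin n → Zd d) → Set Ω := fun q => {ω | N ω = q.1 ∧ ∀ k : Fin q.1, Y k 0 ω = q.2 k}
  have hE : ∀ q, P (E q) = ENNReal.ofReal (poissonProb lam q.1) * ∏ k, ENNReal.ofReal (neqMeasure d K (q.2 k)) := by
    rintro ⟨n, z⟩
    have := hlaw n 0 (fun k _ => if hk : k < n then z ⟨k, hk⟩ else 0)
    rw [Finset.prod_range, ENNReal.ofReal_mul (poisson_nonneg _ hl.le _), ENNReal.ofReal_prod_of_nonneg] at this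
    · simp only [pathProb] at this
      simp only [not_lt_zero, false_imp_iff, implies_true, if_true, pow_zero, mul_one, Fin.is_lt, dif_pos, Fin.eta] at this
      rw [← this]
      congr 1
      ext ω
      simp only [E, Set.mem_ofPred_eq]
      refine and_congr_right fun _ => ⟨fun hh k hk t ht => ?_, fun hh k => ?_⟩
      · obtain rfl : t = 0 := by omega
        rw [dif_pos hk]; exact hh ⟨k, hk⟩
      · have := hh k.1 k.2 0 (Nat.le_refl 0)
        simpa using this
    · intro i _
      exact pathProb_nonneg _ _ _ _
  have hmeas : ∀ q, MeasurableSet (E q) := by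
    intro q
    have : E q = N ⁻¹' {q.1} ∩ ⋂ k : Fin q.1, (Y k 0) ⁻¹' {q.2 k} := by
      ext ω; simp [E]
    rw [this]
    exact (hN (MeasurableSet.singleton _)).inter (MeasurableSet.iInter fun k => hY _ _ (MeasurableSet.singleton _))
  have hdisj : Pairwise (Function.onFun (AEDisjoint P) E) := by
    intro q r hqr
    apply Disjoint.aedisjoint
    rw [Set.disjoint_left]
    rintro ω ⟨h1, h2⟩ ⟨h3, h4⟩
    apply hqr
    obtain ⟨n, z⟩ := q
    obtain ⟨n', z'⟩ := r
    change N ω = n at h1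
    change N ω = n' at h3
    change ∀ k : Fin n, Y k 0 ω = z k at h2
    change ∀ k : Fin n', Y k 0 ω = z' k at h4
    subst h1
    subst h3
    congr 1
    ext1 k
    rw [← h2, ← h4]
  have hle := tsum_measure_le_measure_univ (μ := P) (fun q => (hmeas q).nullMeasurableSet) hdisj
  rw [measure_univ] at hle
  simp_rw [hE] at hle
  rw [ENNReal.tsum_sigma'] at hle
  have hpi : ∀ n : ℕ, ∑' z : Fin n → Zd d, ∏ k, ENNReal.ofReal (neqMeasure d K (z k)) = S ^ n :=
    fun n => tsum_pi_pow (fun z => ENNReal.ofReal (neqMeasure d K z)) n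
  simp_rw [ENNReal.tsum_mul_left, hpi] at hle
  have : ∑' n, ENNReal.ofReal (poissonProb lam n) < ∑' n, ENNReal.ofReal (poissonProb lam n) * S ^ n := by
    apply ENNReal.tsum_lt_tsum (i := 1)
    · rw [tsum_poisson _ hl.le]; simp
    · intro n
      exact le_mul_of_one_le_right' (one_le_pow_of_one_le' hcon.le n)
    · rw [pow_one]
      have hp : 0 < poissonProb lam 1 := by unfold poissonProb; positivity
      calc ENNReal.ofReal (poissonProb lam 1) = ENNReal.ofReal (poissonProb lam 1) * 1 := by rw [mul_one]
        _ < _ := ENNReal.mul_lt_mul_right (by simpa using hp) (by simp) hcon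
  rw [tsum_poisson _ hl.le] at this
  exact absurd hle (not_le.mpr this)

open Classical in
lemma level_link (d : ℕ) (hd : 3 ≤ d) (u : ℝ) {Ω : Type} [MeasurableSpace Ω] (P : Measure Ω) [IsProbabilityMeasure P]
    (K : Set (Zd d)) (N : Ω → ℕ) (Y : ℕ → ℕ → Ω → Zd d) (h : HasLevelLaw d u P K N Y)
    (hl : 0 < u * capacity d K) (T n : ℕ) (Bad : Set (Zd d) → Prop) (p : ℝ)
    (hbad : ∀ z : Fin n → Zd d, Eavg T (fun l => if Bad (rangeSet T z l) then 1 else 0) ≤ p) :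
    P {ω | N ω = n ∧ Bad {y | ∃ k < N ω, ∃ t, 1 ≤ t ∧ t ≤ T ∧ Y k t ω = y}} ≤
      ENNReal.ofReal (poissonProb (u * capacity d K) n) * ENNReal.ofReal p := by
  have hS := start_mass d u P K N Y h hl
  obtain ⟨hY, hN, hlaw⟩ := h
  have key : ∀ w : Fin n → ℕ → Zd d, P ({ω | N ω = n} ∩ {ω | ∀ k : Fin n, ∀ t ≤ T, Y k t ω = w k t}) =
      ENNReal.ofReal (poissonProb (u * capacity d K) n) * ∏ k, ENNReal.ofReal (pathProb d (neqMeasure d K) T (w k)) := by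
    intro w
    have := hlaw n T (fun k => if hk : k < n then w ⟨k, hk⟩ else 0)
    rw [Finset.prod_range, ENNReal.ofReal_mul (poisson_nonneg _ hl.le _), ENNReal.ofReal_prod_of_nonneg] at this
    · simp only [Fin.is_lt, dif_pos, Fin.eta] at this
      rw [← this]
      congr 1
      ext ω
      simp only [Set.mem_inter_iff, Set.mem_ofPred_eq]
      refine and_congr_right fun _ => ⟨fun hh k hk t ht => ?_, fun hh k t ht => ?_⟩
      · rw [dif_pos hk]; exact hh ⟨k, hk⟩ t ht
      · have := hh k k.2 t ht
        simpa using this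
    · intro i _
      exact pathProb_nonneg _ _ _ _
  have := link d hd n T P {ω | N ω = n} (fun k => Y k) (fun z => ENNReal.ofReal (neqMeasure d K z))
    (ENNReal.ofReal (poissonProb (u * capacity d K) n)) hS ?_ ?_ Bad p hbad
  · refine le_trans (measure_mono ?_) this
    rintro ω ⟨h1, h2⟩
    refine ⟨h1, ?_⟩
    simp only [Set.mem_ofPred_eq]
    convert h2 using 3
    rename_i y
    constructor
    · rintro ⟨k, hk⟩; exact ⟨k, by rw [h1]; exact k.2, hk⟩
    · rintro ⟨k, hk, hk2⟩; exact ⟨⟨k, by rw [← h1]; exact hk⟩, hk2⟩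
  · intro w hw
    rw [key]
    push Not at hw
    obtain ⟨k, t, ht, hs⟩ := hw
    have : ∏ k, ENNReal.ofReal (pathProb d (neqMeasure d K) T (w k)) = 0 := by
      apply Finset.prod_eq_zero (Finset.mem_univ k)
      unfold pathProb
      rw [if_neg (fun hh => hs (hh t ht))]
      simp
    rw [this, mul_zero]
  · intro w
    rw [key]
    gcongr with k _
    unfold pathProb
    split_ifs
    · rw [ENNReal.ofReal_mul (neq_nonneg _ _ _)]
    · simp

lemma level_bound (d : ℕ) (hd : 3 ≤ d) (c0 : ℝ)
    (hc0 : ∀ n m B T : ℕ, 0 < n → 0 < m → 2 * m * B ≤ T → ∀ z : Fin n → Zd d,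
      Eavg T (fun l => open Classical in if capacity d (rangeSet T z l) < c0 * min (n * √m) ((m:ℝ)^(((d:ℝ)-2)/2)) then 1 else 0) ≤ (1/2)^B)
    (u : ℝ) {Ω : Type} [MeasurableSpace Ω] (P : Measure Ω) [IsProbabilityMeasure P]
    (K : Set (Zd d)) (N : Ω → ℕ) (Y : ℕ → ℕ → Ω → Zd d) (h : HasLevelLaw d u P K N Y)
    (hl : 0 < u * capacity d K) (m B T : ℕ) (hm : 0 < m) (hT : 2 * m * B ≤ T) :
    P {ω | ¬ (u * capacity d K / 4 < N ω ∧ c0 * min (N ω * √m) ((m:ℝ)^(((d:ℝ)-2)/2)) ≤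
        capacity d {y | ∃ k < N ω, ∃ t, 1 ≤ t ∧ t ≤ T ∧ Y k t ω = y})} ≤
      ENNReal.ofReal (Real.exp (-(u * capacity d K / 4))) + ENNReal.ofReal ((1/2)^B) := by
  classical
  set lam := u * capacity d K with hlam
  have h1 : P {ω | (N ω : ℝ) ≤ lam / 4} ≤ ENNReal.ofReal (Real.exp (-(lam / 4))) := by
    refine le_trans ?_ (chernoff lam hl.le)
    calc P {ω | (N ω : ℝ) ≤ lam / 4} ≤ P (⋃ n : ℕ, if (n:ℝ) ≤ lam/4 then {ω | N ω = n} else ∅) := by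
          apply measure_mono
          intro ω hω
          refine Set.mem_iUnion.mpr ⟨N ω, ?_⟩
          rw [if_pos (show (N ω : ℝ) ≤ lam / 4 from hω)]; rfl
      _ ≤ ∑' n : ℕ, P (if (n:ℝ) ≤ lam/4 then {ω | N ω = n} else ∅) := measure_iUnion_le _
      _ ≤ _ := by
          refine ENNReal.tsum_le_tsum fun n => ?_
          split_ifs
          · have := level_link d hd u P K N Y h hl T n (fun _ => True) 1 (fun z => by
              have : Nonempty (St d) := ⟨(⟨0, by omega⟩, true)⟩
              simp [Eavg_const])
            simpa using this
          · simp
  have h2 : P {ω | 0 < N ω ∧ capacity d {y | ∃ k < N ω, ∃ t, 1 ≤ t ∧ t ≤ T ∧ Y k t ω = y} <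
      c0 * min (N ω * √m) ((m:ℝ)^(((d:ℝ)-2)/2))} ≤ ENNReal.ofReal ((1/2)^B) := by
    let F : ℕ → Set Ω := fun n => if 0 < n then {ω | N ω = n ∧ capacity d {y | ∃ k < N ω, ∃ t, 1 ≤ t ∧ t ≤ T ∧ Y k t ω = y} <
      c0 * min (n * √m) ((m:ℝ)^(((d:ℝ)-2)/2))} else ∅
    calc _ ≤ P (⋃ n : ℕ, F n) := by
          apply measure_mono
          rintro ω ⟨hω, hω2⟩
          refine Set.mem_iUnion.mpr ⟨N ω, ?_⟩
          simp only [F]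
          rw [if_pos hω]; exact ⟨rfl, hω2⟩
      _ ≤ ∑' n : ℕ, P (F n) := measure_iUnion_le _
      _ ≤ ∑' n : ℕ, ENNReal.ofReal (poissonProb lam n) * ENNReal.ofReal ((1/2)^B) := by
          refine ENNReal.tsum_le_tsum fun n => ?_
          simp only [F]
          split_ifs with hn
          · exact level_link d hd u P K N Y h hl T n (fun V => capacity d V < c0 * min (n * √m) ((m:ℝ)^(((d:ℝ)-2)/2))) _
              (hc0 n m B T hn hm hT)
          · simp
      _ = _ := by rw [ENNReal.tsum_mul_right, tsum_poisson _ hl.le, one_mul]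
  refine le_trans (measure_mono ?_) ((measure_union_le _ _).trans (add_le_add h1 h2))
  intro ω hω
  by_cases hc : (N ω : ℝ) ≤ lam/4
  · left; exact hc
  · right
    push Not at hc
    refine ⟨?_, ?_⟩
    · have : (0:ℝ) < N ω := lt_trans (by positivity) hc
      exact_mod_cast this
    · by_contra hh
      push Not at hh
      exact hω ⟨hc, hh⟩


/-! ### Choice of block parameters -/

lemma block_params (ε : ℝ) (hε : ε ∈ Set.Ioo (0:ℝ) (1/2)) (T : ℕ) (hT : 1 ≤ T) :
    ∃ m B : ℕ, 0 < m ∧ 2 * m * B ≤ T ∧ (1/2 : ℝ) ^ B ≤ 2 * Real.exp (-(1/8) * (T:ℝ) ^ (ε/2)) ∧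
      (T:ℝ) ^ ((1-ε)/2) ≤ √m ∧ ∀ a : ℝ, 0 ≤ a → (T:ℝ) ^ (a * (1-ε)/2) ≤ (m:ℝ) ^ (a/2) := by
  obtain ⟨h0, h1⟩ := hε
  have hT1 : (1:ℝ) ≤ T := by exact_mod_cast hT
  have hT0 : (0:ℝ) < T := by linarith
  set q := (T:ℝ) ^ (1-ε) with hq
  have hq1 : 1 ≤ q := Real.one_le_rpow hT1 (by linarith)
  have hm1 : q ≤ (⌈q⌉₊ : ℝ) := Nat.le_ceil q
  have hm2 : (⌈q⌉₊ : ℝ) < q + 1 := Nat.ceil_lt_add_one (by linarith)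
  have hm0 : 0 < ⌈q⌉₊ := Nat.ceil_pos.mpr (by linarith)
  have hpow : ∀ a : ℝ, 0 ≤ a → (T:ℝ) ^ (a * (1-ε)/2) ≤ (⌈q⌉₊:ℝ) ^ (a/2) := by
    intro a ha
    calc (T:ℝ) ^ (a * (1-ε)/2) = q ^ (a/2) := by
          rw [hq, ← Real.rpow_mul hT0.le]; congr 1; ring
      _ ≤ _ := Real.rpow_le_rpow (by linarith) hm1 (by linarith)
  refine ⟨⌈q⌉₊, T / (2 * ⌈q⌉₊), hm0, Nat.mul_div_le _ _, ?_, ?_, hpow⟩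
  · set B := T / (2 * ⌈q⌉₊) with hB
    have hB1 : T < 2 * ⌈q⌉₊ * (B + 1) := by
      have := Nat.lt_mul_div_succ T (show 0 < 2 * ⌈q⌉₊ by omega)
      simpa [hB] using this
    have hB2 : (T:ℝ) < 2 * ⌈q⌉₊ * ((B:ℝ) + 1) := by exact_mod_cast hB1
    have hB3 : (T:ℝ) ^ ε ≤ 4 * ((B:ℝ)+1) := by
      have hTq : (T:ℝ) = q * (T:ℝ) ^ ε := by
        rw [hq, ← Real.rpow_add hT0]; simp
      have : q * (T:ℝ) ^ ε ≤ q * (4 * ((B:ℝ)+1)) := by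
        rw [← hTq]
        have hBp : (0:ℝ) ≤ (B:ℝ) + 1 := by positivity
        nlinarith
      exact le_of_mul_le_mul_left this (by linarith)
    have hB4 : (T:ℝ) ^ (ε/2) ≤ (T:ℝ) ^ ε := Real.rpow_le_rpow_of_exponent_le hT1 (by linarith)
    have h12 : (1/2 : ℝ) ≤ Real.exp (-(1/2)) := by
      have := Real.add_one_le_exp (-(1/2) : ℝ)
      linarith
    calc (1/2 : ℝ) ^ B = 2 * (1/2) ^ (B+1) := by rw [pow_succ]; ring
      _ ≤ 2 * Real.exp (-(1/2)) ^ (B+1) := by gcongr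
      _ = 2 * Real.exp (((B+1 : ℕ):ℝ) * -(1/2)) := by rw [← Real.exp_nat_mul]
      _ ≤ _ := by
        refine mul_le_mul_of_nonneg_left (Real.exp_le_exp.mpr ?_) (by norm_num)
        push_cast
        linarith
  · rw [Real.sqrt_eq_rpow]
    have := hpow 1 zero_le_one
    simpa using this

/-! ### Measurability and the finite-set decomposition -/

lemma Uset_finite (d T : ℕ) {Ω : Type} (X : ℕ → Ω → Zd d) (N : ℕ → Ω → ℕ)
    (Y : ℕ → ℕ → ℕ → Ω → Zd d) (i : ℕ) (ω : Ω) : (Uset d T X N Y i ω).Finite := by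
  unfold Uset
  split_ifs
  · refine ((Set.finite_Icc 1 T).image (fun t => X t ω)).subset ?_
    rintro z ⟨t, h1, h2, rfl⟩
    exact ⟨t, ⟨h1, h2⟩, rfl⟩
  · refine (((Set.finite_Iio (N i ω)).prod (Set.finite_Icc 1 T)).image (fun q => Y i q.1 q.2 ω)).subset ?_
    rintro z ⟨k, hk, t, h1, h2, rfl⟩
    exact ⟨(k, t), ⟨hk, ⟨h1, h2⟩⟩, rfl⟩

/-- extend a finite family of finite sets to a sequence of sets, indexed from one -/
def extK {d s : ℕ} (κ : Fin s → Finset (Zd d)) (j : ℕ) : Set (Zd d) :=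
  if h : j - 1 < s then (κ ⟨j - 1, h⟩ : Set (Zd d)) else ∅

/-- the event that the first sets are prescribed -/
def evA (d T : ℕ) {Ω : Type} (X : ℕ → Ω → Zd d) (N : ℕ → Ω → ℕ)
    (Y : ℕ → ℕ → ℕ → Ω → Zd d) (i : ℕ) (κ : ℕ → Set (Zd d)) : Set Ω :=
  {ω | ∀ j, 1 ≤ j → j < i → Uset d T X N Y j ω = κ j}

lemma exists_K (d T : ℕ) {Ω : Type} (X : ℕ → Ω → Zd d) (N : ℕ → Ω → ℕ)
    (Y : ℕ → ℕ → ℕ → Ω → Zd d) (s : ℕ) (ω : Ω) :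
    ∃ κ : Fin s → Finset (Zd d), ω ∈ evA d T X N Y (s+1) (extK κ) := by
  refine ⟨fun k => (Uset_finite d T X N Y (k+1) ω).toFinset, fun j h1 h2 => ?_⟩
  have hj : j - 1 < s := by omega
  have hj1 : j - 1 + 1 = j := by omega
  simp only [extK, dif_pos hj, Set.Finite.coe_toFinset, hj1]

lemma meas_U (d T : ℕ) (u : ℝ) {Ω : Type} [MeasurableSpace Ω] (P : Measure Ω) [IsProbabilityMeasure P]
    (X : ℕ → Ω → Zd d) (N : ℕ → Ω → ℕ) (Y : ℕ → ℕ → ℕ → Ω → Zd d) (s : ℕ)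
    (hX : ∀ t, Measurable (X t))
    (h : ∀ i, 2 ≤ i → i ≤ s → ∀ κ : ℕ → Set (Zd d), P (evA d T X N Y i κ) ≠ 0 →
      HasLevelLaw d u (P[|evA d T X N Y i κ]) (κ (i-1)) (N i) (Y i))
    (i : ℕ) (hi : i ≤ s) (K : Set (Zd d)) : MeasurableSet {ω | Uset d T X N Y i ω = K} := by
  have hz : ∀ z, MeasurableSet {ω | z ∈ Uset d T X N Y i ω} := by
    intro z
    by_cases h1 : i ≤ 1
    · have : {ω | z ∈ Uset d T X N Y i ω} = ⋃ t ∈ Set.Icc 1 T, X t ⁻¹' {z} := by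
        ext ω
        simp [Uset, h1, and_assoc]
      rw [this]
      exact MeasurableSet.biUnion (Set.to_countable _) fun t _ => hX t (MeasurableSet.singleton _)
    · have hm : (∀ k t, Measurable (Y i k t)) ∧ Measurable (N i) := by
        obtain ⟨i, rfl⟩ : ∃ j, i = j + 1 := ⟨i - 1, by omega⟩
        obtain ⟨κ, hκ⟩ : ∃ κ : Fin i → Finset (Zd d), P (evA d T X N Y (i+1) (extK κ)) ≠ 0 := by
          by_contra hcon
          push Not at hcon
          have h2 := measure_iUnion_null hcon
          have h3 : (⋃ κ : Fin i → Finset (Zd d), evA d T X N Y (i+1) (extK κ)) = Set.univ := by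
            apply Set.eq_univ_of_forall
            intro ω
            exact Set.mem_iUnion.mpr (exists_K d T X N Y i ω)
          rw [h3, measure_univ] at h2
          exact one_ne_zero h2
        have := h (i+1) (by omega) hi _ hκ
        exact ⟨this.1, this.2.1⟩
      have : {ω | z ∈ Uset d T X N Y i ω} =
          ⋃ k, (N i ⁻¹' Set.Ioi k) ∩ ⋃ t ∈ Set.Icc 1 T, Y i k t ⁻¹' {z} := by
        ext ω
        simp [Uset, h1, and_assoc]
      rw [this]
      exact MeasurableSet.iUnion fun k => (hm.2 measurableSet_Ioi).inter
        (MeasurableSet.biUnion (Set.to_countable _) fun t _ => hm.1 k t (MeasurableSet.singleton _))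
  have : {ω | Uset d T X N Y i ω = K} = ⋂ z, {ω | z ∈ Uset d T X N Y i ω ↔ z ∈ K} := by
    ext ω
    simp [Set.ext_iff]
  rw [this]
  refine MeasurableSet.iInter fun z => ?_
  by_cases hzK : z ∈ K
  · simpa [hzK] using hz z
  · have : {ω | z ∈ Uset d T X N Y i ω ↔ z ∈ K} = {ω | z ∈ Uset d T X N Y i ω}ᶜ := by
      ext ω
      simp [hzK]
    rw [this]
    exact (hz z).compl

lemma meas_A (d T : ℕ) (u : ℝ) {Ω : Type} [MeasurableSpace Ω] (P : Measure Ω) [IsProbabilityMeasure P]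
    (X : ℕ → Ω → Zd d) (N : ℕ → Ω → ℕ) (Y : ℕ → ℕ → ℕ → Ω → Zd d) (s : ℕ)
    (hX : ∀ t, Measurable (X t))
    (h : ∀ i, 2 ≤ i → i ≤ s → ∀ κ : ℕ → Set (Zd d), P (evA d T X N Y i κ) ≠ 0 →
      HasLevelLaw d u (P[|evA d T X N Y i κ]) (κ (i-1)) (N i) (Y i))
    (κ : ℕ → Set (Zd d)) : MeasurableSet (evA d T X N Y (s+1) κ) := by
  have : evA d T X N Y (s+1) κ = ⋂ j ∈ Set.Ico 1 (s+1), {ω | Uset d T X N Y j ω = κ j} := by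
    ext ω
    simp [evA]
  rw [this]
  refine MeasurableSet.biInter (Set.to_countable _) fun j hj => ?_
  exact meas_U d T u P X N Y s hX h j (by have := hj.2; omega) _

lemma disj_A (d T : ℕ) {Ω : Type} (X : ℕ → Ω → Zd d) (N : ℕ → Ω → ℕ) (Y : ℕ → ℕ → ℕ → Ω → Zd d) (s : ℕ)
    (κ κ' : Fin s → Finset (Zd d)) (hne : κ ≠ κ') :
    Disjoint (evA d T X N Y (s+1) (extK κ)) (evA d T X N Y (s+1) (extK κ')) := by
  rw [Set.disjoint_left]
  intro ω h1 h2
  apply hne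
  ext1 k
  have e := (h1 (k+1) (by omega) (by omega)).symm.trans (h2 (k+1) (by omega) (by omega))
  simpa [extK] using e

/-! ### The two steps of the induction -/

lemma base_bound (d : ℕ) (hd : 3 ≤ d) (c0 : ℝ)
    (hc0 : ∀ n m B T : ℕ, 0 < n → 0 < m → 2 * m * B ≤ T → ∀ z : Fin n → Zd d,
      Eavg T (fun l => open Classical in if capacity d (rangeSet T z l) < c0 * min (n * √m) ((m:ℝ)^(((d:ℝ)-2)/2)) then 1 else 0) ≤ (1/2)^B)
    {Ω : Type} [MeasurableSpace Ω] (P : Measure Ω) (x : Zd d)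
    (X : ℕ → Ω → Zd d) (hX : IsSRW d P X x) (m B T : ℕ) (hm : 0 < m) (hT : 2 * m * B ≤ T) :
    P {ω | capacity d {y | ∃ t, 1 ≤ t ∧ t ≤ T ∧ X t ω = y} < c0 * min (√m) ((m:ℝ)^(((d:ℝ)-2)/2))} ≤
      ENNReal.ofReal ((1/2)^B) := by
  classical
  have hcast : ((2 * d : ℝ≥0∞))⁻¹ ^ T = ENNReal.ofReal (((2 * (d : ℝ))⁻¹) ^ T) := by
    have hd0 : (0:ℝ) < 2 * d := by
      have : (0:ℝ) < d := by exact_mod_cast (by omega : 0 < d)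
      linarith
    rw [ENNReal.ofReal_pow (by positivity), ENNReal.ofReal_inv_of_pos hd0,
      ENNReal.ofReal_mul (by norm_num)]
    simp
  have key : ∀ w : Fin 1 → ℕ → Zd d, P (Set.univ ∩ {ω | ∀ k : Fin 1, ∀ t ≤ T, X t ω = w k t}) =
      if w 0 0 = x ∧ ∀ k < T, IsStep (w 0 k) (w 0 (k+1)) then ((2 * d : ℝ≥0∞))⁻¹ ^ T else 0 := by
    intro w
    rw [← hX.2 T (w 0)]
    congr 1
    ext ω
    simp
  have := link d hd 1 T P Set.univ (fun _ => X) (fun z => if z = x then 1 else 0) 1 (by simp) ?_ ?_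
    (fun V => capacity d V < c0 * min ((1:ℕ) * √m) ((m:ℝ)^(((d:ℝ)-2)/2))) _ (hc0 1 m B T one_pos hm hT)
  · rw [one_mul] at this
    refine le_trans (measure_mono ?_) this
    intro ω hω
    refine ⟨trivial, ?_⟩
    simpa using hω
  · intro w hw
    rw [key, if_neg]
    rintro ⟨-, h⟩
    apply hw
    intro k
    rw [Subsingleton.elim k 0]
    exact h
  · intro w
    rw [key]
    split_ifs with h
    · rw [← hcast]
      simp [h.1]
    · simp

lemma arith_step {q a b κ n r M c0 c' : ℝ} (hq : 1 ≤ q) (ha : 0 < a) (hb : 0 < b) (hκ : 0 < κ) (hc0 : 0 < c0)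
    (hn : κ * min a b ≤ n) (hr : q ≤ r) (hM : b ≤ M) (hc' : c' ≤ c0 * min 1 κ) :
    c' * min (a * q) b ≤ c0 * min (n * r) M := by
  have hab : 0 < min a b := lt_min ha hb
  have hx : 0 < min (a*q) b := lt_min (by positivity) hb
  have h1 : min (a*q) b ≤ min a b * q := by
    rcases le_total a b with h | h
    · rw [min_eq_left h]; exact min_le_left _ _
    · rw [min_eq_right h]
      exact (min_le_right _ _).trans (le_mul_of_one_le_right hb.le hq)
  have h2 : κ * min (a*q) b ≤ n * r := by
    calc κ * min (a*q) b ≤ κ * (min a b * q) := by gcongr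
      _ = (κ * min a b) * q := by ring
      _ ≤ n * r := by
        have : 0 < κ * min a b := by positivity
        gcongr
        exact this.le.trans hn
  have h3 : min 1 κ * min (a*q) b ≤ min (n*r) M := by
    apply le_min
    · refine le_trans ?_ h2
      gcongr
      exact min_le_right _ _
    · refine le_trans ?_ ((min_le_right (a*q) b).trans hM)
      calc min 1 κ * min (a*q) b ≤ 1 * min (a*q) b := by gcongr; exact min_le_left _ _
        _ = _ := one_mul _
  calc c' * min (a*q) b ≤ (c0 * min 1 κ) * min (a*q) b := by gcongr
    _ = c0 * (min 1 κ * min (a*q) b) := by ring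
    _ ≤ _ := by gcongr


lemma step_bound (d : ℕ) (hd : 3 ≤ d) (c0 : ℝ) (hc00 : 0 < c0)
    (hc0 : ∀ n m B T : ℕ, 0 < n → 0 < m → 2 * m * B ≤ T → ∀ z : Fin n → Zd d,
      Eavg T (fun l => open Classical in if capacity d (rangeSet T z l) < c0 * min (n * √m) ((m:ℝ)^(((d:ℝ)-2)/2)) then 1 else 0) ≤ (1/2)^B)
    (u : ℝ) (hu : 0 < u) (ε : ℝ) (hε : ε ∈ Set.Ioo (0:ℝ) (1/2)) (s : ℕ) (hs : 1 ≤ s) (c c' : ℝ) (hc : 0 < c)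
    (hc1 : c' ≤ 1/8) (hc2 : c' ≤ u * c / 4) (hc3 : c' ≤ c0 * min 1 (u * c / 4))
    (T : ℕ) (hT : 1 ≤ T) {Ω : Type} [MeasurableSpace Ω] (Q : Measure Ω) [IsProbabilityMeasure Q]
    (K : Set (Zd d)) (N : Ω → ℕ) (Y : ℕ → ℕ → Ω → Zd d) (h : HasLevelLaw d u Q K N Y)
    (hK : c * min ((T : ℝ) ^ ((s : ℝ) * (1 - ε) / 2)) ((T : ℝ) ^ (((d : ℝ) - 2) * (1 - ε) / 2)) ≤ capacity d K) :
    Q {ω | capacity d {y | ∃ k < N ω, ∃ t, 1 ≤ t ∧ t ≤ T ∧ Y k t ω = y} <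
      c' * min ((T : ℝ) ^ (((s+1 : ℕ) : ℝ) * (1 - ε) / 2)) ((T : ℝ) ^ (((d : ℝ) - 2) * (1 - ε) / 2))} ≤
      ENNReal.ofReal (3 * Real.exp (-c' * (T:ℝ) ^ (ε/2))) := by
  obtain ⟨m, B, hm, hmB, hB, hq, hpow⟩ := block_params ε hε T hT
  obtain ⟨he0, he1⟩ := hε
  have hT1 : (1:ℝ) ≤ T := by exact_mod_cast hT
  have hT0 : (0:ℝ) < T := by linarith
  have hd3 : (3:ℝ) ≤ d := by exact_mod_cast hd
  have hs1 : (1:ℝ) ≤ s := by exact_mod_cast hs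
  set a := (T : ℝ) ^ ((s : ℝ) * (1 - ε) / 2) with ha
  set b := (T : ℝ) ^ (((d : ℝ) - 2) * (1 - ε) / 2) with hb
  set q := (T : ℝ) ^ ((1-ε)/2) with hqd
  set f := (T : ℝ) ^ (ε/2) with hf
  have ha0 : 0 < a := Real.rpow_pos_of_pos hT0 _
  have hb0 : 0 < b := Real.rpow_pos_of_pos hT0 _
  have hf0 : 0 < f := Real.rpow_pos_of_pos hT0 _
  have hq1 : 1 ≤ q := Real.one_le_rpow hT1 (by linarith)
  have hfa : f ≤ a := Real.rpow_le_rpow_of_exponent_le hT1 (by nlinarith)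
  have hfb : f ≤ b := Real.rpow_le_rpow_of_exponent_le hT1 (by nlinarith)
  have haq : (T : ℝ) ^ (((s+1 : ℕ) : ℝ) * (1 - ε) / 2) = a * q := by
    rw [ha, hqd, ← Real.rpow_add hT0]; congr 1; push_cast; ring
  have hmin : 0 < min a b := lt_min ha0 hb0
  have hcap : 0 < capacity d K := lt_of_lt_of_le (by positivity) hK
  have hlam : u * c / 4 * min a b ≤ u * capacity d K / 4 := by
    have := mul_le_mul_of_nonneg_left hK hu.le
    nlinarith
  have hexp : Real.exp (-(u * capacity d K / 4)) ≤ Real.exp (-c' * f) := by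
    apply Real.exp_le_exp.mpr
    have h1 : c' * f ≤ u * c / 4 * f := by gcongr
    have h2 : u * c / 4 * f ≤ u * c / 4 * min a b := by
      gcongr
      exact le_min hfa hfb
    linarith
  have hB' : (1/2 : ℝ) ^ B ≤ 2 * Real.exp (-c' * f) := by
    refine hB.trans ?_
    have : -(1/8) * f ≤ -c' * f := by nlinarith
    have := Real.exp_le_exp.mpr this
    linarith
  have hlb := level_bound d hd c0 hc0 u Q K N Y h (by positivity) m B T hm hmB
  refine (measure_mono ?_).trans (hlb.trans ?_)
  · intro ω hω
    rintro ⟨h1, h2⟩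
    refine absurd (show _ < _ from hω) (not_lt.mpr (le_trans ?_ h2))
    rw [haq]
    exact arith_step hq1 ha0 hb0 (by positivity) hc00 (hlam.trans h1.le) hq (hpow _ (by linarith)) hc3
  · rw [← ENNReal.ofReal_add (by positivity) (by positivity)]
    apply ENNReal.ofReal_le_ofReal
    linarith

lemma main_induction (d : ℕ) (hd : 3 ≤ d) (u : ℝ) (hu : 0 < u)
    (ε : ℝ) (hε : ε ∈ Set.Ioo (0:ℝ) (1/2)) (s : ℕ) (hs : 1 ≤ s) :
    ∃ c C : ℝ, 0 < c ∧ 0 < C ∧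
    ∀ (x : Zd d) (T : ℕ), 1 ≤ T →
    ∀ (Ω : Type) (_ : MeasurableSpace Ω) (P : Measure Ω), IsProbabilityMeasure P →
    ∀ (X : ℕ → Ω → Zd d) (N : ℕ → Ω → ℕ) (Y : ℕ → ℕ → ℕ → Ω → Zd d),
    IsSRW d P X x →
    (∀ i, 2 ≤ i → i ≤ s → ∀ κ : ℕ → Set (Zd d), P (evA d T X N Y i κ) ≠ 0 →
      HasLevelLaw d u (P[|evA d T X N Y i κ]) (κ (i-1)) (N i) (Y i)) →
      P {ω | ∃ i, 1 ≤ i ∧ i ≤ s ∧ capacity d (Uset d T X N Y i ω) <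
          c * min ((T : ℝ) ^ ((i : ℝ) * (1 - ε) / 2))
                  ((T : ℝ) ^ (((d : ℝ) - 2) * (1 - ε) / 2))} ≤
       ENNReal.ofReal (C * Real.exp (-c * (T : ℝ) ^ (ε / 2))) := by
  classical
  obtain ⟨c0, hc00, hc0⟩ := range_prob d hd
  have hd3 : (3:ℝ) ≤ d := by exact_mod_cast hd
  induction s, hs using Nat.le_induction with
  | base =>
    refine ⟨min c0 (1/8), 2, lt_min hc00 (by norm_num), by norm_num, ?_⟩
    intro x T hT Ω _ P hP X N Y hX _
    obtain ⟨m, B, hm, hmB, hB, hq, hpow⟩ := block_params ε hε T hT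
    have hT1 : (1:ℝ) ≤ T := by exact_mod_cast hT
    have hT0 : (0:ℝ) < T := by linarith
    refine (measure_mono ?_).trans ((base_bound d hd c0 hc0 P x X hX m B T hm hmB).trans ?_)
    · rintro ω ⟨i, h1, h2, h3⟩
      obtain rfl : i = 1 := le_antisymm h2 h1
      have hU : Uset d T X N Y 1 ω = {y | ∃ t, 1 ≤ t ∧ t ≤ T ∧ X t ω = y} := by simp [Uset]
      rw [hU] at h3
      refine lt_of_lt_of_le (show _ < _ from h3) ?_
      have h4 : (T : ℝ) ^ (((1:ℕ) : ℝ) * (1 - ε) / 2) ≤ √m := by simpa using hq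
      have h5 := hpow ((d:ℝ) - 2) (by linarith)
      have h6 : (0:ℝ) ≤ min ((T : ℝ) ^ (((1:ℕ) : ℝ) * (1 - ε) / 2)) ((T : ℝ) ^ (((d : ℝ) - 2) * (1 - ε) / 2)) := by
        positivity
      exact mul_le_mul (min_le_left _ _) (min_le_min h4 h5) h6 hc00.le
    · apply ENNReal.ofReal_le_ofReal
      refine hB.trans ?_
      have hf0 : 0 < (T : ℝ) ^ (ε/2) := Real.rpow_pos_of_pos hT0 _
      have : min c0 (1/8) ≤ 1/8 := min_le_right _ _
      refine mul_le_mul_of_nonneg_left (Real.exp_le_exp.mpr ?_) (by norm_num)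
      nlinarith
  | succ s hs ih =>
    obtain ⟨c, C, hc, hC, ih⟩ := ih
    set c' := min (min c (1/8)) (min (u * c / 4) (c0 * min 1 (u * c / 4))) with hc'
    have hc'0 : 0 < c' := by
      have : 0 < u * c / 4 := by positivity
      refine lt_min (lt_min hc (by norm_num)) (lt_min this (mul_pos hc00 (lt_min one_pos this)))
    have hcc : c' ≤ c := (min_le_left _ _).trans (min_le_left _ _)
    have hc1 : c' ≤ 1/8 := (min_le_left _ _).trans (min_le_right _ _)
    have hc2 : c' ≤ u * c / 4 := (min_le_right _ _).trans (min_le_left _ _)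
    have hc3 : c' ≤ c0 * min 1 (u * c / 4) := (min_le_right _ _).trans (min_le_right _ _)
    refine ⟨c', C + 3, hc'0, by linarith, ?_⟩
    intro x T hT Ω _ P hP X N Y hX hlev
    have hT1 : (1:ℝ) ≤ T := by exact_mod_cast hT
    have hT0 : (0:ℝ) < T := by linarith
    have hlev' : ∀ i, 2 ≤ i → i ≤ s → ∀ κ : ℕ → Set (Zd d), P (evA d T X N Y i κ) ≠ 0 →
      HasLevelLaw d u (P[|evA d T X N Y i κ]) (κ (i-1)) (N i) (Y i) :=
      fun i h1 h2 => hlev i h1 (by omega)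
    have hih := ih x T hT Ω _ P hP X N Y hX hlev'
    let th : ℕ → ℝ := fun i => min ((T : ℝ) ^ ((i : ℝ) * (1 - ε) / 2)) ((T : ℝ) ^ (((d : ℝ) - 2) * (1 - ε) / 2))
    have hth : ∀ i, 0 ≤ th i := fun i => by positivity
    let bl : Set Ω := {ω | capacity d (Uset d T X N Y (s+1) ω) < c' * th (s+1)}
    let A : (Fin s → Finset (Zd d)) → Set Ω := fun κ => evA d T X N Y (s+1) (extK κ)
    let G : (Fin s → Finset (Zd d)) → Set Ω := fun κ =>
      if c * th s ≤ capacity d (extK κ s) then A κ ∩ bl else ∅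
    have hAm : ∀ κ, MeasurableSet (A κ) := fun κ => meas_A d T u P X N Y s hX.1 hlev' _
    set δ := ENNReal.ofReal (3 * Real.exp (-c' * (T:ℝ) ^ (ε/2))) with hδ
    have hG : ∀ κ, P (G κ) ≤ P (A κ) * δ := by
      intro κ
      simp only [G]
      split_ifs with hk
      · by_cases h0 : P (A κ) = 0
        · rw [h0, zero_mul]
          exact (measure_mono Set.inter_subset_left).trans h0.le
        · have hl := hlev (s+1) (by omega) le_rfl (extK κ) h0
          have : IsProbabilityMeasure (P[|A κ]) := cond_isProbabilityMeasure h0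
          have hb := step_bound d hd c0 hc00 hc0 u hu ε hε s hs c c' hc hc1 hc2 hc3 T hT (P[|A κ])
            (extK κ s) (N (s+1)) (Y (s+1)) hl hk
          rw [← cond_mul_eq_inter (hAm κ), mul_comm]
          gcongr
          refine (measure_mono ?_).trans hb
          intro ω hω
          have hU : Uset d T X N Y (s+1) ω = {y | ∃ k < N (s+1) ω, ∃ t, 1 ≤ t ∧ t ≤ T ∧ Y (s+1) k t ω = y} := by
            simp only [Uset]
            rw [if_neg (by omega)]
          have hω' : capacity d (Uset d T X N Y (s+1) ω) < c' * th (s+1) := hω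
          rw [hU] at hω'
          exact hω'
      · simp
    have hsum : ∑' κ, P (A κ) ≤ 1 := by
      have := tsum_measure_le_measure_univ (μ := P) (fun κ => (hAm κ).nullMeasurableSet)
        (fun κ κ' hne => (disj_A d T X N Y s κ κ' hne).aedisjoint)
      rwa [measure_univ] at this
    have hGU : P (⋃ κ, G κ) ≤ δ := by
      calc P (⋃ κ, G κ) ≤ ∑' κ, P (G κ) := measure_iUnion_le _
        _ ≤ ∑' κ, P (A κ) * δ := ENNReal.tsum_le_tsum hG
        _ = (∑' κ, P (A κ)) * δ := ENNReal.tsum_mul_right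
        _ ≤ 1 * δ := by gcongr
        _ = δ := one_mul _
    refine (measure_mono ?_).trans ((measure_union_le _ _).trans ((add_le_add hih hGU).trans ?_))
    · rintro ω ⟨i, h1, h2, h3⟩
      by_cases hbs : ∃ i, 1 ≤ i ∧ i ≤ s ∧ capacity d (Uset d T X N Y i ω) < c * th i
      · left; exact hbs
      · right
        push Not at hbs
        have h3' : capacity d (Uset d T X N Y i ω) < c' * th i := h3
        obtain rfl : i = s + 1 := by
          by_contra hne
          have := hbs i h1 (by omega)
          have h4 : c' * th i ≤ c * th i := mul_le_mul_of_nonneg_right hcc (hth i)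
          linarith
        obtain ⟨κ, hκ⟩ := exists_K d T X N Y s ω
        refine Set.mem_iUnion.mpr ⟨κ, ?_⟩
        simp only [G]
        rw [if_pos]
        · exact ⟨hκ, h3'⟩
        · rw [← hκ s hs (by omega)]
          exact hbs s hs le_rfl
    · rw [hδ, ← ENNReal.ofReal_add (by positivity) (by positivity)]
      apply ENNReal.ofReal_le_ofReal
      have hf0 : 0 < (T : ℝ) ^ (ε/2) := Real.rpow_pos_of_pos hT0 _
      have : Real.exp (-c * (T:ℝ) ^ (ε/2)) ≤ Real.exp (-c' * (T:ℝ) ^ (ε/2)) := by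
        apply Real.exp_le_exp.mpr
        nlinarith
      have := mul_le_mul_of_nonneg_left this hC.le
      linarith

/-- For `d ≥ 3`, `u > 0`, `ε ∈ (0,1/2)` and a positive integer `s`, there are constants
`c > 0`, `C < ∞` such that for every `x ∈ ℤ^d` and positive integer `T`, the recursively
defined random sets `U⁽¹⁾, …, U⁽ˢ⁾` satisfy
`P[⋂_{i≤s} {cap(U⁽ⁱ⁾) ≥ c · min(T^{i(1-ε)/2}, T^{(d-2)(1-ε)/2})}] ≥ 1 - C exp(-c T^{ε/2})`. -/
theorem Uset_capacity_high_prob (d : ℕ) (hd : 3 ≤ d) (u : ℝ) (hu : 0 < u)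
    (ε : ℝ) (hε : ε ∈ Set.Ioo (0:ℝ) (1/2)) (s : ℕ) (hs : 1 ≤ s) :
    ∃ c C : ℝ, 0 < c ∧ 0 < C ∧
    ∀ (x : Zd d) (T : ℕ), 1 ≤ T →
    ∀ (Ω : Type) (_ : MeasurableSpace Ω) (P : Measure Ω), IsProbabilityMeasure P →
    ∀ (X : ℕ → Ω → Zd d) (N : ℕ → Ω → ℕ) (Y : ℕ → ℕ → ℕ → Ω → Zd d),
    IsSRW d P X x →
    (∀ i, 2 ≤ i → i ≤ s → ∀ 𝒦 : ℕ → Set (Zd d),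
      P {ω | ∀ j, 1 ≤ j → j < i → Uset d T X N Y j ω = 𝒦 j} ≠ 0 →
      HasLevelLaw d u (P[|{ω | ∀ j, 1 ≤ j → j < i → Uset d T X N Y j ω = 𝒦 j}])
        (𝒦 (i-1)) (N i) (Y i)) →
    1 - ENNReal.ofReal (C * Real.exp (-c * (T : ℝ) ^ (ε / 2))) ≤
      P {ω | ∀ i, 1 ≤ i → i ≤ s →
          c * min ((T : ℝ) ^ ((i : ℝ) * (1 - ε) / 2))
                  ((T : ℝ) ^ (((d : ℝ) - 2) * (1 - ε) / 2))
            ≤ capacity d (Uset d T X N Y i ω)} := by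
  obtain ⟨c, C, hc, hC, h⟩ := main_induction d hd u hu ε hε s hs
  refine ⟨c, C, hc, hC, ?_⟩
  intro x T hT Ω _ P hP X N Y hX hlev
  have hb := h x T hT Ω _ P hP X N Y hX hlev
  rw [tsub_le_iff_left]
  refine le_trans ?_ (add_le_add_left hb _)
  refine le_trans ?_ (measure_union_le _ _)
  rw [← measure_univ (μ := P)]
  apply measure_mono
  intro ω _
  by_cases hbad : ∃ i, 1 ≤ i ∧ i ≤ s ∧ capacity d (Uset d T X N Y i ω) <
          c * min ((T : ℝ) ^ ((i : ℝ) * (1 - ε) / 2))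
                  ((T : ℝ) ^ (((d : ℝ) - 2) * (1 - ε) / 2))
  · left; exact hbad
  · right
    push Not at hbad
    exact hbad
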